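/- arXiv:2604.13619 — 3 statements merged into one kernel-verified Lean document; each statement's English description precedes it below -/
import Mathlib

section
/- Let A be a ring and B a commutative ring. Let f : A → B be a central ℤ-linear map, and let m ∈ ℕ be such that the m-Frobenius map f_m is identically zero. Then the n-Frobenius map f_n is identically zero for all integers n ≥ m. -/
open scoped Classical

noncomputable section

/-- A `ℤ`-linear map `f : A → B` is *central* if `f (a * a') = f (a' * a)` for all `a, a'`. -/
def Central {A B : Type*} [Ring A] [CommRing B] (f : A →ₗ[ℤ] B) : Prop :=
  ∀ a a' : A, f (a * a') = f (a' * a)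

/-- The product `a x * a (σ x) * a (σ² x) * ⋯` along the cycle of the permutation `σ`
containing `x`, starting at `x` (the cycle has length `Function.minimalPeriod σ x`). -/
def cycleProdAt {ι A : Type*} [Ring A] (a : ι → A) (σ : Equiv.Perm ι) (x : ι) : A :=
  ((List.range (Function.minimalPeriod (⇑σ) x)).map (fun j => a ((σ ^ j) x))).prod

/-- The Frobenius map of a central `ℤ`-linear map `f : A → B`, applied to a finite family
`a : ι → A`:  `∑_{σ} sgn σ • ∏_{cycles c of σ} f (a_{i₁} a_{i₂} ⋯ a_{i_k})`, where each cycle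
is represented by the product along it starting from its distinguished element (the one
minimizing a fixed enumeration of `ι`); when `f` is central this agrees with the classical
definition, which is independent of the starting points. -/
def frob {ι A B : Type*} [Fintype ι] [DecidableEq ι] [Ring A] [CommRing B]
    (f : A →ₗ[ℤ] B) (a : ι → A) : B :=
  ∑ σ : Equiv.Perm ι, (Equiv.Perm.sign σ : ℤ) •
    ∏ x : ι,
      if ∀ j : ℕ, (Fintype.equivFin ι) x ≤ (Fintype.equivFin ι) ((σ ^ j) x)
      then f (cycleProdAt a σ x) else 1

/-- `f` is an `n`-homomorphism if it is central and its `(n+1)`-Frobenius map vanishes. -/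
def IsNHom {A B : Type*} [Ring A] [CommRing B] (n : ℕ) (f : A →ₗ[ℤ] B) : Prop :=
  Central f ∧ ∀ a : Fin (n + 1) → A, frob f a = 0

/-- `π` is a set partition of the finite set `J`: its blocks are nonempty, pairwise
disjoint, and their union is `J`. -/
def IsSetPartition {α : Type*} [DecidableEq α] (J : Finset α) (π : Finset (Finset α)) : Prop :=
  (∀ P ∈ π, P.Nonempty) ∧
  (∀ P ∈ π, ∀ Q ∈ π, P ≠ Q → Disjoint P Q) ∧
  π.biUnion id = J

/-- Delete the element `n` from the block of `π` containing it (removing the block if it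
becomes empty). -/
def delPart (n : ℕ) (π : Finset (Finset ℕ)) : Finset (Finset ℕ) :=
  (π.image (fun P => P.erase n)).erase ∅

/-- `P` selects exactly one element of each cycle of `σ`. -/
def IsReps {ι : Type*} (σ : Equiv.Perm ι) (P : ι → Prop) : Prop :=
  (∀ x, ∃ y, σ.SameCycle x y ∧ P y) ∧ ∀ x y, P x → P y → σ.SameCycle x y → x = y

theorem prod_reps_eq {ι B : Type*} [Fintype ι] [CommRing B] (σ : Equiv.Perm ι)
    (P Q : ι → Prop) (hP : IsReps σ P) (hQ : IsReps σ Q) (g : ι → B)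
    (hg : ∀ x y, σ.SameCycle x y → g x = g y) :
    (∏ x, if P x then g x else 1) = ∏ x, if Q x then g x else 1 := by
  rw [← Finset.prod_filter, ← Finset.prod_filter]
  choose u hu hu' using hP.1
  choose v hv hv' using hQ.1
  refine Finset.prod_bij' (fun x _ => v x) (fun x _ => u x) ?_ ?_ ?_ ?_ ?_
  · intro x _; simp [hv']
  · intro x _; simp [hu']
  · intro x hx
    simp only [Finset.mem_filter, Finset.mem_univ, true_and] at hx
    exact (hP.2 _ _ hx (hu' _) ((hv x).trans (hu _))).symm
  · intro x hx
    simp only [Finset.mem_filter, Finset.mem_univ, true_and] at hx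
    exact (hQ.2 _ _ hx (hv' _) ((hu x).trans (hv _))).symm
  · intro x _; exact hg _ _ (hv x)

theorem isReps_min {ι : Type*} [Finite ι] {k : ℕ} (σ : Equiv.Perm ι) (e : ι ≃ Fin k) :
    IsReps σ (fun x => ∀ j : ℕ, e x ≤ e ((σ ^ j) x)) := by
  constructor
  · intro x
    obtain ⟨y, hy, hmin⟩ := Set.exists_min_image {y | σ.SameCycle x y} e (Set.toFinite _)
      ⟨x, Equiv.Perm.SameCycle.refl _ _⟩
    refine ⟨y, hy, fun j => hmin _ ?_⟩
    exact Equiv.Perm.SameCycle.trans hy ⟨j, by simp⟩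
  · intro x y hx hy h
    obtain ⟨i, hi⟩ := h.exists_nat_pow_eq
    obtain ⟨j, hj⟩ := h.symm.exists_nat_pow_eq
    apply e.injective
    apply le_antisymm
    · rw [← hi]; exact hx i
    · rw [← hj]; exact hy j

theorem f_cycle_step {ι A B : Type*} [Finite ι] [Ring A] [CommRing B] (f : A →ₗ[ℤ] B)
    (hf : Central f) (a : ι → A) (σ : Equiv.Perm ι) (x : ι) :
    f (cycleProdAt a σ (σ x)) = f (cycleProdAt a σ x) := by
  have hx : x ∈ Function.periodicPts σ :=
    Function.Injective.mem_periodicPts σ.injective x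
  have hk : Function.minimalPeriod σ (σ x) = Function.minimalPeriod σ x :=
    Function.minimalPeriod_apply hx
  have hpos := Function.minimalPeriod_pos_of_mem_periodicPts hx
  have hp : (σ ^ (Function.minimalPeriod σ x)) x = x := by
    have := Function.isPeriodicPt_minimalPeriod σ x
    rwa [Function.IsPeriodicPt, Function.IsFixedPt, Equiv.Perm.iterate_eq_pow] at this
  unfold cycleProdAt
  rw [hk]
  obtain ⟨k, hk'⟩ := Nat.exists_eq_succ_of_ne_zero hpos.ne'
  rw [hk'] at hp ⊢
  conv_rhs => rw [List.range_succ_eq_map]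
  rw [List.range_succ]
  simp only [List.map_append, List.map_map, List.prod_append, List.map_cons, List.prod_cons,
    List.map_nil, List.prod_nil, mul_one, ← Equiv.Perm.mul_apply, ← pow_succ]
  rw [hf]
  congr 1
  simp only [Nat.succ_eq_add_one] at hp
  simp [hp, Function.comp_def]

theorem f_cycle_inv {ι A B : Type*} [Finite ι] [Ring A] [CommRing B] (f : A →ₗ[ℤ] B)
    (hf : Central f) (a : ι → A) (σ : Equiv.Perm ι) (x y : ι) (h : σ.SameCycle x y) :
    f (cycleProdAt a σ x) = f (cycleProdAt a σ y) := by
  obtain ⟨i, rfl⟩ := h.exists_nat_pow_eq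
  induction i with
  | zero => simp
  | succ i ih =>
    rw [pow_succ', Equiv.Perm.mul_apply, f_cycle_step f hf]
    exact ih ⟨i, by simp⟩

/-- If the orbits correspond, so do the cycle products. -/
theorem cycleProdAt_map {ι κ A : Type*} [Ring A] (s : ι → κ) (hs : Function.Injective s)
    (σ : Equiv.Perm ι) (τ : Equiv.Perm κ) (a : ι → A) (c : κ → A) (x : ι)
    (h : ∀ i : ℕ, (τ ^ i) (s x) = s ((σ ^ i) x)) (hc : ∀ i : ℕ, c (s ((σ ^ i) x)) = a ((σ ^ i) x)) :
    cycleProdAt c τ (s x) = cycleProdAt a σ x := by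
  have : Function.minimalPeriod τ (s x) = Function.minimalPeriod σ x := by
    apply Function.minimalPeriod_eq_minimalPeriod_iff.2
    intro i
    simp only [Function.IsPeriodicPt, Function.IsFixedPt, Equiv.Perm.iterate_eq_pow, h, hs.eq_iff]
  unfold cycleProdAt
  rw [this]
  simp only [h, hc]

theorem sameCycle_of_step {ι κ : Type*} [Finite κ] (p : κ → ι) (σ : Equiv.Perm ι)
    (τ : Equiv.Perm κ) (h : ∀ z, σ.SameCycle (p z) (p (τ z))) (z w : κ) (hzw : τ.SameCycle z w) :
    σ.SameCycle (p z) (p w) := by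
  obtain ⟨i, rfl⟩ := hzw.exists_nat_pow_eq
  clear hzw
  induction i with
  | zero => simp [Equiv.Perm.SameCycle.refl]
  | succ i ih =>
    rw [pow_succ', Equiv.Perm.mul_apply]
    exact ih.trans (h _)

theorem sc_step {ι : Type*} (σ : Equiv.Perm ι) (x : ι) : σ.SameCycle x (σ x) := ⟨1, by simp⟩

section step
variable {n : ℕ} (σ : Equiv.Perm (Fin n)) (j : Fin n) (τ : Equiv.Perm (Fin (n + 1)))

theorem reps_insert (h0 : τ 0 = j.succ)
    (hs : ∀ x, τ x.succ = if σ x = j then 0 else (σ x).succ) (P : Fin n → Prop)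
    (hP : IsReps σ P) : IsReps τ (Fin.cases False P : Fin (n + 1) → Prop) := by
  have key1 : ∀ x y : Fin n, σ.SameCycle x y → τ.SameCycle x.succ y.succ := by
    refine sameCycle_of_step Fin.succ τ σ (fun z => ?_)
    by_cases hz : σ z = j
    · refine ⟨2, ?_⟩
      have : (2 : ℤ) = ((2 : ℕ) : ℤ) := rfl
      rw [this, zpow_natCast, pow_two, Equiv.Perm.mul_apply, hs, if_pos hz, h0, hz]
    · refine ⟨1, ?_⟩
      rw [zpow_one, hs, if_neg hz]
  have key2 : ∀ z w : Fin (n + 1), τ.SameCycle z w →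
      σ.SameCycle ((Fin.cases j id : Fin (n + 1) → Fin n) z)
        ((Fin.cases j id : Fin (n + 1) → Fin n) w) := by
    refine sameCycle_of_step _ σ τ (fun z => ?_)
    refine Fin.cases ?_ (fun x => ?_) z
    · rw [h0]; exact Equiv.Perm.SameCycle.refl _ _
    · rw [hs]
      split_ifs with hz
      · have := sc_step σ x
        rw [hz] at this
        exact this
      · exact sc_step σ x
  constructor
  · intro z
    refine Fin.cases ?_ (fun x => ?_) z
    · obtain ⟨y, hy, hy'⟩ := hP.1 j
      refine ⟨y.succ, ?_, hy'⟩
      have := sc_step τ 0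
      rw [h0] at this
      exact this.trans (key1 _ _ hy)
    · obtain ⟨y, hy, hy'⟩ := hP.1 x
      exact ⟨y.succ, key1 _ _ hy, hy'⟩
  · intro z w
    refine Fin.cases ?_ (fun x => ?_) z
    · intro h; exact h.elim
    · refine Fin.cases ?_ (fun y => ?_) w
      · intro _ h; exact h.elim
      · intro hx hy h
        exact congrArg Fin.succ (hP.2 x y hx hy (key2 _ _ h))

theorem cycle_insert {A B : Type*} [Ring A] [CommRing B] (f : A →ₗ[ℤ] B)
    (hf : Central f) (h0 : τ 0 = j.succ)
    (hs : ∀ x, τ x.succ = if σ x = j then 0 else (σ x).succ) (b : A) (a : Fin n → A) (x : Fin n) :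
    f (cycleProdAt (Fin.cons b a : Fin (n + 1) → A) τ x.succ) =
      f (cycleProdAt (Function.update a j (b * a j)) σ x) := by
  by_cases hx : σ.SameCycle x j
  · have hx2 : τ.SameCycle x.succ 0 := by
      obtain ⟨i, hi⟩ := hx.exists_nat_pow_eq
      by_contra hcon
      have hpw : ∀ i : ℕ, (τ ^ (i + 1)) x.succ = ((σ ^ (i + 1)) x).succ := by
        intro i
        induction i with
        | zero =>
          rw [zero_add, pow_one, pow_one, hs]
          split_ifs with hz
          · exact (hcon ⟨1, by rw [zpow_one, hs, if_pos hz]⟩).elim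
          · rfl
        | succ i ih =>
          rw [pow_succ', Equiv.Perm.mul_apply, ih, hs, ← Equiv.Perm.mul_apply, ← pow_succ']
          split_ifs with hz
          · refine (hcon ⟨((i + 1 + 1 : ℕ) : ℤ), ?_⟩).elim
            rw [zpow_natCast, pow_succ', Equiv.Perm.mul_apply, ih, hs, ← Equiv.Perm.mul_apply,
              ← pow_succ', if_pos hz]
          · rfl
      have hsurj : ∃ i : ℕ, (σ ^ (i + 1)) x = j := by
        obtain ⟨i, hi⟩ := (show σ.SameCycle (σ x) j from
          (sc_step σ x).symm.trans hx).exists_nat_pow_eq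
        exact ⟨i, by rw [pow_succ, Equiv.Perm.mul_apply, hi]⟩
      obtain ⟨i, hi⟩ := hsurj
      apply hcon
      refine Equiv.Perm.SameCycle.symm ((sc_step τ 0).trans ?_)
      rw [h0, ← hi, ← hpw]
      exact Equiv.Perm.SameCycle.symm ⟨((i + 1 : ℕ) : ℤ), by rw [zpow_natCast]⟩
    rw [f_cycle_inv f hf _ τ _ _ hx2, f_cycle_inv f hf _ σ _ _ hx]
    congr 1
    have hjp : j ∈ Function.periodicPts σ :=
      Function.Injective.mem_periodicPts σ.injective j
    have hpos := Function.minimalPeriod_pos_of_mem_periodicPts hjp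
    have hp : (σ ^ (Function.minimalPeriod σ j)) j = j := by
      have := Function.isPeriodicPt_minimalPeriod σ j
      rwa [Function.IsPeriodicPt, Function.IsFixedPt, Equiv.Perm.iterate_eq_pow] at this
    have hne : ∀ i, 0 < i → i < Function.minimalPeriod σ j → (σ ^ i) j ≠ j := by
      intro i hi hlt heq
      have : Function.IsPeriodicPt σ i j := by
        rwa [Function.IsPeriodicPt, Function.IsFixedPt, Equiv.Perm.iterate_eq_pow]
      exact absurd (this.minimalPeriod_le hi) (not_le.2 hlt)
    have hτ : ∀ i, i < Function.minimalPeriod σ j → (τ ^ (i + 1)) 0 = ((σ ^ i) j).succ := by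
      intro i
      induction i with
      | zero => intro _; simp [h0]
      | succ i ih =>
        intro hi
        rw [pow_succ', Equiv.Perm.mul_apply, ih (by omega), hs, ← Equiv.Perm.mul_apply,
          ← pow_succ', if_neg (hne _ (by omega) hi)]
    have hper : Function.minimalPeriod τ 0 = Function.minimalPeriod σ j + 1 := by
      apply le_antisymm
      · apply Function.IsPeriodicPt.minimalPeriod_le (Nat.succ_pos _)
        rw [Function.IsPeriodicPt, Function.IsFixedPt, Equiv.Perm.iterate_eq_pow]
        obtain ⟨k, hk⟩ := Nat.exists_eq_succ_of_ne_zero hpos.ne'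
        rw [hk] at hp hτ ⊢
        rw [pow_succ', Equiv.Perm.mul_apply, hτ k (Nat.lt_succ_self k), hs,
          ← Equiv.Perm.mul_apply, ← pow_succ', if_pos hp]
      · by_contra hlt
        have hpos' := Function.minimalPeriod_pos_of_mem_periodicPts
          (Function.Injective.mem_periodicPts τ.injective 0)
        have hfix : (τ ^ (Function.minimalPeriod τ 0)) 0 = 0 := by
          have := Function.isPeriodicPt_minimalPeriod τ 0
          rwa [Function.IsPeriodicPt, Function.IsFixedPt, Equiv.Perm.iterate_eq_pow] at this
        obtain ⟨k, hk⟩ := Nat.exists_eq_succ_of_ne_zero hpos'.ne'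
        rw [hk] at hfix hlt
        rw [hτ k (by omega)] at hfix
        exact Fin.succ_ne_zero _ hfix
    unfold cycleProdAt
    rw [hper]
    obtain ⟨k, hk⟩ := Nat.exists_eq_succ_of_ne_zero hpos.ne'
    rw [hk] at hτ hne ⊢
    rw [List.range_succ_eq_map, List.map_cons, List.prod_cons, List.map_map]
    have e1 : List.map ((fun i => (Fin.cons b a : Fin (n + 1) → A) ((τ ^ i) 0)) ∘ Nat.succ)
        (List.range (k + 1)) = List.map (fun i => a ((σ ^ i) j)) (List.range (k + 1)) := by
      apply List.map_congr_left
      intro i hi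
      rw [List.mem_range] at hi
      simp only [Function.comp]
      rw [Nat.succ_eq_add_one, hτ i hi, Fin.cons_succ]
    rw [Nat.succ_eq_add_one, e1, List.range_succ_eq_map, List.map_cons, List.prod_cons,
      List.map_cons, List.prod_cons, List.map_map, List.map_map]
    have e2 : List.map ((fun i => Function.update a j (b * a j) ((σ ^ i) j)) ∘ Nat.succ)
        (List.range k) = List.map ((fun i => a ((σ ^ i) j)) ∘ Nat.succ) (List.range k) := by
      apply List.map_congr_left
      intro i hi
      rw [List.mem_range] at hi
      simp only [Function.comp]
      rw [Function.update_of_ne (hne _ (by omega) (by omega))]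
    have e3 : Function.update a j (b * a j) ((σ ^ 0) j) = b * a j :=
      Function.update_self (f := a) j (b * a j)
    rw [e2, e3]
    simp [mul_assoc]
  · congr 1
    have hne : ∀ i : ℕ, (σ ^ i) x ≠ j := fun i hi => hx ⟨i, by rw [zpow_natCast, hi]⟩
    apply cycleProdAt_map Fin.succ (Fin.succ_injective n)
    · intro i
      induction i with
      | zero => simp
      | succ i ih =>
        rw [pow_succ', Equiv.Perm.mul_apply, ih, hs, ← Equiv.Perm.mul_apply,
          ← pow_succ', if_neg (hne _)]
    · intro i
      rw [Fin.cons_succ, Function.update_of_ne (hne _)]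

theorem pow_fix (hs : ∀ x : Fin n, τ x.succ = (σ x).succ) (x : Fin n) (i : ℕ) :
    (τ ^ i) x.succ = ((σ ^ i) x).succ := by
  induction i with
  | zero => simp
  | succ i ih =>
    rw [pow_succ', Equiv.Perm.mul_apply, ih, hs, pow_succ', Equiv.Perm.mul_apply]

theorem reps_fix (h0 : τ 0 = 0) (hs : ∀ x : Fin n, τ x.succ = (σ x).succ) (P : Fin n → Prop)
    (hP : IsReps σ P) : IsReps τ (Fin.cases True P : Fin (n + 1) → Prop) := by
  have key1 : ∀ x y : Fin n, σ.SameCycle x y → τ.SameCycle x.succ y.succ := by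
    refine sameCycle_of_step Fin.succ τ σ (fun z => ?_)
    rw [← hs]; exact sc_step τ _
  have hz : ∀ z, τ.SameCycle 0 z → z = 0 := by
    intro z h
    obtain ⟨i, rfl⟩ := h.exists_nat_pow_eq
    clear h
    induction i with
    | zero => rfl
    | succ i ih => rw [pow_succ', Equiv.Perm.mul_apply, ih, h0]
  constructor
  · intro z
    refine Fin.cases ?_ (fun x => ?_) z
    · exact ⟨0, Equiv.Perm.SameCycle.refl _ _, trivial⟩
    · obtain ⟨y, hy, hy'⟩ := hP.1 x
      exact ⟨y.succ, key1 _ _ hy, hy'⟩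
  · intro z w
    refine Fin.cases ?_ (fun x => ?_) z
    · intro _ _ h; exact (hz _ h).symm
    · refine Fin.cases ?_ (fun y => ?_) w
      · intro _ _ h; exact hz _ h.symm
      · intro hx hy h
        obtain ⟨i, hi⟩ := h.exists_nat_pow_eq
        rw [pow_fix σ τ hs] at hi
        exact congrArg Fin.succ (hP.2 x y hx hy
          ⟨i, by rw [zpow_natCast]; exact Fin.succ_injective n hi⟩)

end step

/-- The product over the cycles of `σ`. -/
def cycTerm {ι A B : Type*} [Fintype ι] [Ring A] [CommRing B]
    (f : A →ₗ[ℤ] B) (a : ι → A) (σ : Equiv.Perm ι) : B :=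
  ∏ x : ι, if ∀ j : ℕ, (Fintype.equivFin ι) x ≤ (Fintype.equivFin ι) ((σ ^ j) x)
      then f (cycleProdAt a σ x) else 1

theorem cycTerm_eq {ι A B : Type*} [Fintype ι] [Ring A] [CommRing B]
    (f : A →ₗ[ℤ] B) (hf : Central f) (a : ι → A) (σ : Equiv.Perm ι) (P : ι → Prop)
    (hP : IsReps σ P) :
    cycTerm f a σ = ∏ x : ι, if P x then f (cycleProdAt a σ x) else 1 :=
  prod_reps_eq σ _ P (isReps_min σ (Fintype.equivFin ι)) hP _ (f_cycle_inv f hf a σ)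

theorem cycTerm_fix {n : ℕ} {A B : Type*} [Ring A] [CommRing B]
    (f : A →ₗ[ℤ] B) (hf : Central f) (b : A) (a : Fin n → A) (σ : Equiv.Perm (Fin n))
    (τ : Equiv.Perm (Fin (n + 1))) (h0 : τ 0 = 0) (hs : ∀ x : Fin n, τ x.succ = (σ x).succ) :
    cycTerm f (Fin.cons b a : Fin (n + 1) → A) τ = f b * cycTerm f a σ := by
  rw [cycTerm_eq f hf _ τ _ (reps_fix σ τ h0 hs _ (isReps_min σ (Fintype.equivFin (Fin n)))),
    Fin.prod_univ_succ]
  have h1 : cycleProdAt (Fin.cons b a : Fin (n + 1) → A) τ 0 = b := by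
    have : Function.minimalPeriod τ 0 = 1 := Function.minimalPeriod_eq_one_iff_isFixedPt.2 h0
    unfold cycleProdAt
    rw [this]
    simp
  have h2 : ∀ x : Fin n, cycleProdAt (Fin.cons b a : Fin (n + 1) → A) τ x.succ =
      cycleProdAt a σ x := fun x =>
    cycleProdAt_map Fin.succ (Fin.succ_injective n) σ τ _ _ x (pow_fix σ τ hs x)
      (fun i => by rw [Fin.cons_succ])
  simp only [h1, h2, Fin.cases_zero, Fin.cases_succ, if_true, cycTerm]

theorem cycTerm_insert {n : ℕ} {A B : Type*} [Ring A] [CommRing B]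
    (f : A →ₗ[ℤ] B) (hf : Central f) (b : A) (a : Fin n → A) (σ : Equiv.Perm (Fin n)) (j : Fin n)
    (τ : Equiv.Perm (Fin (n + 1))) (h0 : τ 0 = j.succ)
    (hs : ∀ x : Fin n, τ x.succ = if σ x = j then 0 else (σ x).succ) :
    cycTerm f (Fin.cons b a : Fin (n + 1) → A) τ =
      cycTerm f (Function.update a j (b * a j)) σ := by
  rw [cycTerm_eq f hf _ τ _ (reps_insert σ j τ h0 hs _ (isReps_min σ (Fintype.equivFin (Fin n)))),
    Fin.prod_univ_succ]
  simp only [cycle_insert σ j τ f hf h0 hs, Fin.cases_zero, Fin.cases_succ, cycTerm]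
  refine (congrArg (fun t => t * _) (if_neg ?_)).trans (one_mul _)
  exact not_false

theorem frob_eq {ι A B : Type*} [Fintype ι] [DecidableEq ι] [Ring A] [CommRing B]
    (f : A →ₗ[ℤ] B) (a : ι → A) :
    frob f a = ∑ σ : Equiv.Perm ι, (Equiv.Perm.sign σ : ℤ) • cycTerm f a σ := rfl

theorem frob_cons {n : ℕ} {A B : Type*} [Ring A] [CommRing B]
    (f : A →ₗ[ℤ] B) (hf : Central f) (b : A) (a : Fin n → A) :
    frob f (Fin.cons b a : Fin (n + 1) → A) =
      f b * frob f a - ∑ j, frob f (Function.update a j (b * a j)) := by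
  simp only [frob_eq]
  rw [← Equiv.sum_comp Equiv.Perm.decomposeFin.symm, Fintype.sum_prod_type, Fin.sum_univ_succ,
    sub_eq_add_neg, Finset.mul_sum, ← Finset.sum_neg_distrib]
  congr 1
  · refine Finset.sum_congr rfl fun σ _ => ?_
    rw [cycTerm_fix f hf b a σ _ (by simp) (by simp)]
    rw [Equiv.Perm.decomposeFin.symm_sign]
    simp [mul_left_comm]
  · refine Finset.sum_congr rfl fun j _ => ?_
    rw [← Finset.sum_neg_distrib]
    refine Finset.sum_congr rfl fun σ _ => ?_
    rw [cycTerm_insert f hf b a σ j _ (by simp) ?_]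
    · rw [Equiv.Perm.decomposeFin.symm_sign]
      simp [Fin.succ_ne_zero]
    · intro x
      rw [Equiv.Perm.decomposeFin_symm_apply_succ, Equiv.swap_apply_def]
      simp [Fin.succ_ne_zero]

/-- If the `m`-Frobenius map of a central map `f` vanishes identically, then so does the
`n`-Frobenius map for every `n ≥ m`. -/
theorem stmt3 {A B : Type*} [Ring A] [CommRing B] (f : A →ₗ[ℤ] B) (hf : Central f)
    (m : ℕ) (hm : ∀ a : Fin m → A, frob f a = 0)
    (n : ℕ) (hn : m ≤ n) (a : Fin n → A) :
    frob f a = 0 := by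
  induction n, hn using Nat.le_induction with
  | base => exact hm a
  | succ n _ ih =>
    rw [← Fin.cons_self_tail a, frob_cons f hf]
    simp [ih]
end
end

section
/- Let A, B and C be three rings with B and C commutative. Let g : A → B and f : B → C be two central ℤ-linear maps, and set h := f ∘ g : A → C. Let n ∈ ℕ and a_1, …, a_n ∈ A. For any subset P = {p_1, …, p_r} of [n] (with p_1, …, p_r distinct), set b_P := g_r(a_{p_1}, a_{p_2}, …, a_{p_r}) ∈ B (well-defined by symmetry of g_r). Then h_n(a_1, a_2, …, a_n) = Σ_{π = {P_1, P_2, …, P_k} ∈ Π_{[n]}} f_k(b_{P_1}, b_{P_2}, …, b_{P_k}), where the sum ranges over all set partitions π of [n] into (distinct, disjoint, nonempty) blocks P_1, …, P_k, and where f_k(b_{P_1}, …, b_{P_k}) is well-defined by symmetry of f_k. -/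
open scoped Classical

noncomputable section

namespace FrobAux

open Equiv.Perm Function

def IsTrans {ι : Type*} (σ : Equiv.Perm ι) (p : ι → Prop) : Prop :=
  (∀ x, ∃ y, SameCycle σ x y ∧ p y) ∧ ∀ x y, SameCycle σ x y → p x → p y → x = y

theorem prod_trans {ι B : Type*} [Fintype ι] [CommRing B] (σ : Equiv.Perm ι) (p : ι → Prop)
    (hp : IsTrans σ p) (F : ι → B) (hF : ∀ x y, SameCycle σ x y → F x = F y) :
    (∏ x, if p x then F x else 1) =
      ∏ q : Quotient (SameCycle.setoid σ), F q.out := by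
  rw [← Finset.prod_fiberwise (s := Finset.univ)
    (g := fun x => (Quotient.mk (SameCycle.setoid σ) x))]
  refine Finset.prod_congr rfl fun q _ => ?_
  obtain ⟨y, hy, hpy⟩ := hp.1 q.out
  have hqy : Quotient.mk (SameCycle.setoid σ) y = q := by
    rw [← Quotient.out_eq q]
    exact Quotient.sound (s := SameCycle.setoid σ) hy.symm
  rw [Finset.prod_eq_single y]
  · rw [if_pos hpy]; exact (hF _ _ hy).symm
  · intro z hz hzy
    rw [if_neg]
    intro hpz
    apply hzy
    refine hp.2 z y ?_ hpz hpy
    have hzq := (Finset.mem_filter.1 hz).2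
    exact Quotient.exact (s := SameCycle.setoid σ) (hzq.trans hqy.symm)
  · intro h; exact absurd (by simpa using hqy) h

theorem isTrans_key {ι : Type*} [Fintype ι] (σ : Equiv.Perm ι) {m : ℕ} (k : ι → Fin m)
    (hk : Function.Injective k) :
    IsTrans σ (fun x => ∀ j : ℕ, k x ≤ k ((σ ^ j) x)) := by
  constructor
  · intro x
    obtain ⟨y, hy, hmin⟩ := Finset.exists_min_image
      (Finset.univ.filter (fun y => SameCycle σ x y)) k ⟨x, by simp [SameCycle.refl]⟩
    have hy' := (Finset.mem_filter.1 hy).2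
    refine ⟨y, hy', fun j => hmin _ ?_⟩
    simpa using hy'
  · intro x y h hx hy
    apply hk
    obtain ⟨i, hi⟩ := h.exists_nat_pow_eq
    obtain ⟨j, hj⟩ := h.symm.exists_nat_pow_eq
    apply le_antisymm
    · rw [← hi]; exact hx i
    · rw [← hj]; exact hy j

theorem mem_periodic {ι : Type*} [Finite ι] (σ : Equiv.Perm ι) (x : ι) :
    x ∈ Function.periodicPts σ :=
  Function.Injective.mem_periodicPts σ.injective x

theorem period_pos {ι : Type*} [Finite ι] (σ : Equiv.Perm ι) (x : ι) :
    0 < Function.minimalPeriod σ x :=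
  Function.minimalPeriod_pos_of_mem_periodicPts (mem_periodic σ x)

theorem pow_period {ι : Type*} (σ : Equiv.Perm ι) (x : ι) :
    (σ ^ (Function.minimalPeriod σ x)) x = x := by
  have := Function.isPeriodicPt_minimalPeriod σ x
  rw [← Equiv.Perm.iterate_eq_pow]
  exact this

theorem cpa_step {ι A B : Type*} [Finite ι] [Ring A] [CommRing B] (f : A →ₗ[ℤ] B)
    (hf : Central f) (a : ι → A) (σ : Equiv.Perm ι) (x : ι) :
    f (cycleProdAt a σ (σ x)) = f (cycleProdAt a σ x) := by
  unfold cycleProdAt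
  rw [Function.minimalPeriod_apply (mem_periodic σ x)]
  have h2 := pow_period σ x
  obtain ⟨m, hm⟩ := Nat.exists_eq_succ_of_ne_zero (period_pos σ x).ne'
  rw [hm] at h2 ⊢
  rw [List.prod_range_succ, List.prod_range_succ', hf]
  congr 2
  rw [← Equiv.Perm.mul_apply, ← pow_succ, h2]
  rfl

theorem cpa_inv {ι A B : Type*} [Finite ι] [Ring A] [CommRing B] (f : A →ₗ[ℤ] B)
    (hf : Central f) (a : ι → A) (σ : Equiv.Perm ι) (x y : ι) (h : SameCycle σ x y) :
    f (cycleProdAt a σ x) = f (cycleProdAt a σ y) := by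
  obtain ⟨i, rfl⟩ := h.exists_nat_pow_eq
  induction i with
  | zero => rfl
  | succ i ih =>
    rw [pow_succ', Equiv.Perm.mul_apply, cpa_step f hf]
    exact ih (by simp [SameCycle.refl])

theorem frob_eq {ι A B : Type*} [Fintype ι] [DecidableEq ι] [Ring A] [CommRing B]
    (f : A →ₗ[ℤ] B) (hf : Central f) (a : ι → A) (p : Equiv.Perm ι → ι → Prop)
    (hp : ∀ σ, IsTrans σ (p σ)) :
    frob f a = ∑ σ : Equiv.Perm ι, (Equiv.Perm.sign σ : ℤ) •
      ∏ x : ι, if p σ x then f (cycleProdAt a σ x) else 1 := by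
  unfold frob
  refine Finset.sum_congr rfl fun σ _ => ?_
  rw [prod_trans σ _ (hp σ) (fun x => f (cycleProdAt a σ x)) (cpa_inv f hf a σ),
    ← prod_trans σ _ (isTrans_key σ _ (Fintype.equivFin ι).injective)
      (fun x => f (cycleProdAt a σ x)) (cpa_inv f hf a σ)]

theorem cpa_congr {ι κ A : Type*} [Ring A] (a : ι → A) (b : κ → A)
    (σ : Equiv.Perm ι) (τ : Equiv.Perm κ) (x : ι) (y : κ) (e : ι → κ) (he : Injective e)
    (h : ∀ j : ℕ, (τ ^ j) y = e ((σ ^ j) x)) (hab : ∀ j : ℕ, a ((σ ^ j) x) = b ((τ ^ j) y)) :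
    cycleProdAt a σ x = cycleProdAt b τ y := by
  unfold cycleProdAt
  have : Function.minimalPeriod σ x = Function.minimalPeriod τ y := by
    rw [Function.minimalPeriod_eq_minimalPeriod_iff]
    intro n
    unfold Function.IsPeriodicPt Function.IsFixedPt
    rw [Equiv.Perm.iterate_eq_pow, Equiv.Perm.iterate_eq_pow, h n]
    have h0 := h 0
    simp only [pow_zero, Equiv.Perm.coe_one, id] at h0
    rw [h0]
    exact he.eq_iff.symm
  rw [this]
  congr 1
  exact List.map_congr_left fun j _ => hab j

theorem permCongr_pow {ι κ : Type*} (e : ι ≃ κ) (σ : Equiv.Perm ι) (j : ℕ) (x : ι) :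
    ((e.permCongr σ) ^ j) (e x) = e ((σ ^ j) x) := by
  induction j with
  | zero => rfl
  | succ j ih => rw [pow_succ', pow_succ', Equiv.Perm.mul_apply, ih, Equiv.Perm.mul_apply]; simp

theorem frob_reindex {ι κ A B : Type*} [Fintype ι] [DecidableEq ι] [Fintype κ] [DecidableEq κ]
    [Ring A] [CommRing B] (f : A →ₗ[ℤ] B) (hf : Central f) (e : ι ≃ κ) (a : κ → A) :
    frob f (fun x => a (e x)) = frob f a := by
  rw [frob_eq f hf (fun x => a (e x)) _ (fun σ => isTrans_key σ
    (fun x => (Fintype.equivFin κ) (e x)) ((Fintype.equivFin κ).injective.comp e.injective))]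
  unfold frob
  refine Fintype.sum_equiv e.permCongr _ _ fun σ => ?_
  rw [Equiv.Perm.sign_permCongr]
  congr 1
  refine Fintype.prod_equiv e _ _ fun x => ?_
  simp only [permCongr_pow]
  rw [cpa_congr (fun x => a (e x)) a σ (e.permCongr σ) x (e x) e e.injective
    (fun j => permCongr_pow e σ j x) (fun j => by rw [permCongr_pow])]

def cyc {ι A B : Type*} [Fintype ι] [Ring A] [CommRing B]
    (f : A →ₗ[ℤ] B) (a : ι → A) (σ : Equiv.Perm ι) : B :=
  ∏ q : Quotient (SameCycle.setoid σ), f (cycleProdAt a σ q.out)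

theorem cyc_eq {ι A B : Type*} [Fintype ι] [Ring A] [CommRing B]
    (f : A →ₗ[ℤ] B) (hf : Central f) (a : ι → A) (σ : Equiv.Perm ι) (p : ι → Prop)
    (hp : IsTrans σ p) :
    cyc f a σ = ∏ x : ι, if p x then f (cycleProdAt a σ x) else 1 :=
  (prod_trans σ p hp (fun x => f (cycleProdAt a σ x)) (cpa_inv f hf a σ)).symm

theorem frob_cyc {ι A B : Type*} [Fintype ι] [DecidableEq ι] [Ring A] [CommRing B]
    (f : A →ₗ[ℤ] B) (hf : Central f) (a : ι → A) :
    frob f a = ∑ σ : Equiv.Perm ι, (Equiv.Perm.sign σ : ℤ) • cyc f a σ := by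
  unfold frob
  refine Finset.sum_congr rfl fun σ _ => ?_
  rw [cyc_eq f hf a σ _ (isTrans_key σ _ (Fintype.equivFin ι).injective)]

theorem exists_isTrans {ι : Type*} [Fintype ι] (σ : Equiv.Perm ι) : ∃ p, IsTrans σ p :=
  ⟨_, isTrans_key σ _ (Fintype.equivFin ι).injective⟩

theorem optionCongr_pow {ι : Type*} (σ : Equiv.Perm ι) (j : ℕ) (x : ι) :
    ((Equiv.optionCongr σ : Equiv.Perm (Option ι)) ^ j) (some x) = some ((σ ^ j) x) := by
  induction j with
  | zero => rfl
  | succ j ih => rw [pow_succ', pow_succ', Equiv.Perm.mul_apply, ih, Equiv.Perm.mul_apply]; simp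

theorem optionCongr_pow_none {ι : Type*} (σ : Equiv.Perm ι) (j : ℕ) :
    ((Equiv.optionCongr σ : Equiv.Perm (Option ι)) ^ j) none = none := by
  induction j with
  | zero => rfl
  | succ j ih => rw [pow_succ', Equiv.Perm.mul_apply, ih]; simp

theorem cyc_option_none {ι A B : Type*} [Fintype ι] [Ring A] [CommRing B]
    (f : A →ₗ[ℤ] B) (hf : Central f) (b : Option ι → A) (σ : Equiv.Perm ι) :
    cyc f b (Equiv.optionCongr σ) = f (b none) * cyc f (fun x => b (some x)) σ := by
  obtain ⟨p, hp⟩ := exists_isTrans σ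
  have hp' : IsTrans (Equiv.optionCongr σ : Equiv.Perm (Option ι))
      (fun z => ∀ x, z = some x → p x) := by
    constructor
    · rintro (_ | x)
      · exact ⟨none, SameCycle.refl _ _, by simp⟩
      · obtain ⟨y, hy, hpy⟩ := hp.1 x
        obtain ⟨i, hi⟩ := hy.exists_nat_pow_eq
        exact ⟨some y, ⟨i, by rw [zpow_natCast, optionCongr_pow, hi]⟩, by simpa using hpy⟩
    · intro x y h hx hy
      obtain ⟨i, hi⟩ := h.exists_nat_pow_eq
      rcases x with _ | x
      · rw [optionCongr_pow_none] at hi; exact hi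
      · rw [optionCongr_pow] at hi
        subst hi
        exact congrArg some
          (hp.2 x ((σ ^ i) x) (by simp [SameCycle.refl]) (hx _ rfl) (hy _ rfl))
  rw [cyc_eq f hf b _ _ hp', cyc_eq f hf _ σ p hp, Fintype.prod_option]
  congr 1
  · rw [if_pos (by simp)]
    congr 1
    unfold cycleProdAt
    have : Function.minimalPeriod (Equiv.optionCongr σ : Equiv.Perm (Option ι)) none = 1 := by
      rw [Function.minimalPeriod_eq_one_iff_isFixedPt]; rfl
    rw [this]; simp
  · refine Finset.prod_congr rfl fun x _ => ?_
    rw [cpa_congr (fun x => b (some x)) b σ (Equiv.optionCongr σ) x (some x) some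
      (Option.some_injective _) (fun j => optionCongr_pow σ j x)
      (fun j => by rw [optionCongr_pow])]
    simp

/-- insertion of `none` just before `j` in its cycle -/
def ins {ι : Type*} [DecidableEq ι] (σ : Equiv.Perm ι) (j : ι) : Equiv.Perm (Option ι) :=
  Equiv.swap none (some j) * Equiv.optionCongr σ

theorem ins_none {ι : Type*} [DecidableEq ι] (σ : Equiv.Perm ι) (j : ι) :
    ins σ j none = some j := by simp [ins]

theorem ins_some_eq {ι : Type*} [DecidableEq ι] (σ : Equiv.Perm ι) (j x : ι) (h : σ x = j) :
    ins σ j (some x) = none := by simp [ins, h]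

theorem ins_some_ne {ι : Type*} [DecidableEq ι] (σ : Equiv.Perm ι) (j x : ι) (h : σ x ≠ j) :
    ins σ j (some x) = some (σ x) := by
  simp [ins]
  rw [Equiv.swap_apply_of_ne_of_ne] <;> simp [h]

theorem ins_same_of {ι : Type*} [Finite ι] [DecidableEq ι] (σ : Equiv.Perm ι) (j x y : ι)
    (h : SameCycle σ x y) : SameCycle (ins σ j) (some x) (some y) := by
  obtain ⟨i, rfl⟩ := h.exists_nat_pow_eq
  clear h
  induction i with
  | zero => exact SameCycle.refl _ _
  | succ i ih =>
    refine ih.trans ?_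
    rw [pow_succ', Equiv.Perm.mul_apply]
    set z := (σ ^ i) x
    by_cases hz : σ z = j
    · refine ⟨2, ?_⟩
      rw [hz, zpow_ofNat, pow_two, Equiv.Perm.mul_apply, ins_some_eq σ j z hz, ins_none]
    · exact ⟨1, by rw [zpow_one, ins_some_ne σ j z hz]⟩

theorem ins_same_to {ι : Type*} [Finite ι] [DecidableEq ι] (σ : Equiv.Perm ι) (j : ι)
    (z w : Option ι) (h : SameCycle (ins σ j) z w) : SameCycle σ (z.getD j) (w.getD j) := by
  obtain ⟨i, rfl⟩ := h.exists_nat_pow_eq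
  clear h
  induction i with
  | zero => exact SameCycle.refl _ _
  | succ i ih =>
    refine ih.trans ?_
    rw [pow_succ', Equiv.Perm.mul_apply]
    rcases (ins σ j ^ i) z with _ | u
    · rw [ins_none]; exact SameCycle.refl _ _
    · by_cases hz : σ u = j
      · rw [ins_some_eq σ j u hz]; exact ⟨1, by simpa using hz⟩
      · rw [ins_some_ne σ j u hz]; exact ⟨1, by simp⟩

theorem cyc_option_some {ι A B : Type*} [Fintype ι] [DecidableEq ι] [Ring A] [CommRing B]
    (f : A →ₗ[ℤ] B) (hf : Central f) (b : Option ι → A) (σ : Equiv.Perm ι) (i : ι) :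
    cyc f b (ins σ (σ i)) =
      cyc f (Function.update (fun x => b (some x)) i (b (some i) * b none)) σ := by
  obtain ⟨p0, hp0⟩ := exists_isTrans σ
  obtain ⟨j, hj⟩ : ∃ j, j = σ i := ⟨_, rfl⟩
  rw [← hj]
  let p : ι → Prop := fun x => if SameCycle σ j x then x = j else p0 x
  have hp : IsTrans σ p := by
    constructor
    · intro x
      by_cases h : SameCycle σ j x
      · exact ⟨j, h.symm, by simp [p, SameCycle.refl]⟩
      · obtain ⟨y, hy, hpy⟩ := hp0.1 x
        refine ⟨y, hy, ?_⟩
        simp only [p]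
        rw [if_neg (fun h' => h (h'.trans hy.symm))]
        exact hpy
    · intro x y h hx hy
      simp only [p] at hx hy
      by_cases h1 : SameCycle σ j x
      · rw [if_pos h1] at hx
        rw [if_pos (h1.trans h)] at hy
        rw [hx, hy]
      · rw [if_neg h1] at hx
        rw [if_neg (fun h' => h1 (h'.trans h.symm))] at hy
        exact hp0.2 _ _ h hx hy
  have hp' : IsTrans (ins σ j) (fun z => ∃ x, z = some x ∧ p x) := by
    constructor
    · rintro (_ | x)
      · exact ⟨some j, ⟨1, by simp [ins_none]⟩, j, rfl, by simp [p, SameCycle.refl]⟩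
      · obtain ⟨y, hy, hpy⟩ := hp.1 x
        exact ⟨some y, ins_same_of σ j x y hy, y, rfl, hpy⟩
    · rintro _ _ h ⟨x, rfl, hx⟩ ⟨y, rfl, hy⟩
      rw [hp.2 x y (by simpa using ins_same_to σ j _ _ h) hx hy]
  rw [cyc_eq f hf b _ _ hp', cyc_eq f hf _ σ p hp, Fintype.prod_option, if_neg (by simp), one_mul]
  refine Finset.prod_congr rfl fun x _ => ?_
  simp only [Option.some.injEq, exists_eq_left']
  by_cases hx : p x
  swap
  · rw [if_neg hx, if_neg hx]
  rw [if_pos hx, if_pos hx]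
  congr 1
  have hx2 := hx
  simp only [p] at hx2
  by_cases h : SameCycle σ j x
  · rw [if_pos h] at hx2
    subst hx2
    obtain ⟨m, hm⟩ := Nat.exists_eq_succ_of_ne_zero (period_pos σ x).ne'
    have hlast : (σ ^ m) x = i := by
      have := pow_period σ x
      rw [hm, Nat.succ_eq_add_one, pow_succ', Equiv.Perm.mul_apply] at this
      exact σ.injective (this.trans hj)
    have hne : ∀ k < m, (σ ^ k) x ≠ i := by
      intro k hk hki
      have : Function.IsPeriodicPt σ (k + 1) x := by
        unfold Function.IsPeriodicPt Function.IsFixedPt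
        rw [Equiv.Perm.iterate_eq_pow, pow_succ', Equiv.Perm.mul_apply, hki, ← hj]
      exact Function.not_isPeriodicPt_of_pos_of_lt_minimalPeriod (Nat.succ_ne_zero k)
        (by omega) this
    have hpw : ∀ k ≤ m, (ins σ x ^ k) (some x) = some ((σ ^ k) x) := by
      intro k
      induction k with
      | zero => intro _; rfl
      | succ k ih =>
        intro hk
        rw [pow_succ', Equiv.Perm.mul_apply, ih (by omega), ins_some_ne, pow_succ',
          Equiv.Perm.mul_apply]
        intro h'
        exact hne k (by omega) (σ.injective (h'.trans hj))
    have hpm : (ins σ x ^ (m + 1)) (some x) = none := by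
      rw [pow_succ', Equiv.Perm.mul_apply, hpw m le_rfl, ins_some_eq]
      rw [hlast, ← hj]
    have hper : Function.minimalPeriod (ins σ x) (some x) = m + 2 := by
      apply le_antisymm
      · apply Function.IsPeriodicPt.minimalPeriod_le (by omega)
        unfold Function.IsPeriodicPt Function.IsFixedPt
        rw [Equiv.Perm.iterate_eq_pow, pow_succ', Equiv.Perm.mul_apply, hpm, ins_none]
      · by_contra hlt
        push Not at hlt
        have h1 := pow_period (ins σ x) (some x)
        have h0 := period_pos (ins σ x) (some x)
        generalize Function.minimalPeriod (ins σ x) (some x) = r at *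
        rcases Nat.lt_or_ge r (m + 1) with hr | hr
        · rw [hpw r (by omega), Option.some.injEq] at h1
          have : Function.IsPeriodicPt σ r x := by
            unfold Function.IsPeriodicPt Function.IsFixedPt
            rw [Equiv.Perm.iterate_eq_pow, h1]
          exact Function.not_isPeriodicPt_of_pos_of_lt_minimalPeriod (by omega)
            (by omega) this
        · have : r = m + 1 := by omega
          rw [this, hpm] at h1
          exact absurd h1 (by simp)
    unfold cycleProdAt
    rw [hper, hm, List.prod_range_succ, List.prod_range_succ, Nat.succ_eq_add_one,
      List.prod_range_succ, hpm, hpw m le_rfl, hlast, Function.update_self, mul_assoc]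
    congr 2
    refine List.map_congr_left fun k hk => ?_
    have hk' := List.mem_range.1 hk
    rw [hpw k hk'.le, Function.update_of_ne (hne k hk')]
  · have hne : ∀ k : ℕ, σ ((σ ^ k) x) ≠ j := by
      intro k hk
      apply h
      rw [← hk]
      simp [SameCycle.refl]
    have hpw : ∀ k : ℕ, (ins σ j ^ k) (some x) = some ((σ ^ k) x) := by
      intro k
      induction k with
      | zero => rfl
      | succ k ih =>
        rw [pow_succ', Equiv.Perm.mul_apply, ih, ins_some_ne _ _ _ (hne k), pow_succ',
          Equiv.Perm.mul_apply]
    symm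
    refine cpa_congr _ b σ (ins σ j) x (some x) some (Option.some_injective _) hpw ?_
    intro k
    rw [hpw, Function.update_of_ne]
    intro h'
    apply hne k
    rw [h', hj]

theorem frob_option {ι A B : Type*} [Fintype ι] [DecidableEq ι] [Ring A] [CommRing B]
    (f : A →ₗ[ℤ] B) (hf : Central f) (b : Option ι → A) :
    frob f b = f (b none) * frob f (fun x => b (some x)) -
      ∑ i, frob f (Function.update (fun x => b (some x)) i (b (some i) * b none)) := by
  simp only [frob_cyc f hf]
  rw [Finset.sum_comm, Finset.mul_sum, ← Finset.sum_sub_distrib,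
    ← Equiv.Perm.decomposeOption.symm.sum_comp, Fintype.sum_prod_type, Fintype.sum_option,
    Finset.sum_comm, ← Finset.sum_add_distrib]
  refine Finset.sum_congr rfl fun σ _ => ?_
  rw [sub_eq_add_neg, ← Finset.sum_neg_distrib, ← Equiv.sum_comp σ]
  congr 1
  · have : Equiv.Perm.decomposeOption.symm (none, σ) = Equiv.optionCongr σ := by
      ext x; simp
    rw [this, Equiv.optionCongr_sign, cyc_option_none f hf, mul_smul_comm]
  · refine Finset.sum_congr rfl fun i _ => ?_
    have : Equiv.Perm.decomposeOption.symm (some (σ i), σ) = ins σ (σ i) := rfl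
    rw [this, cyc_option_some f hf]
    have hs : Equiv.Perm.sign (ins σ (σ i)) = - Equiv.Perm.sign σ := by
      rw [ins, Equiv.Perm.sign_mul, Equiv.Perm.sign_swap (by simp), Equiv.optionCongr_sign]
      simp
    rw [hs]
    simp

def fr {α A B : Type*} [DecidableEq α] [Ring A] [CommRing B]
    (f : A →ₗ[ℤ] B) (J : Finset α) (a : α → A) : B :=
  frob f (fun x : {x // x ∈ J} => a x.1)

theorem fr_congr {α A B : Type*} [DecidableEq α] [Ring A] [CommRing B]
    (f : A →ₗ[ℤ] B) (J : Finset α) (a b : α → A) (h : ∀ x ∈ J, a x = b x) :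
    fr f J a = fr f J b := by
  unfold fr
  congr 1
  funext x
  exact h x.1 x.2

theorem fr_empty {α A B : Type*} [DecidableEq α] [Ring A] [CommRing B]
    (f : A →ₗ[ℤ] B) (a : α → A) : fr f ∅ a = 1 := by
  unfold fr frob
  rw [Fintype.sum_unique]
  simp

theorem fr_insert {α A B : Type*} [DecidableEq α] [Ring A] [CommRing B]
    (f : A →ₗ[ℤ] B) (hf : Central f) (J : Finset α) (x : α) (hx : x ∉ J) (a : α → A) :
    fr f (insert x J) a = f (a x) * fr f J a -
      ∑ i ∈ J, fr f J (Function.update a i (a i * a x)) := by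
  have h1 : fr f (insert x J) a =
      frob f (fun z : Option {i // i ∈ J} => z.elim (a x) (fun y => a y.1)) := by
    rw [← frob_reindex f hf (Finset.subtypeInsertEquivOption hx)]
    unfold fr
    congr 1
    funext y
    by_cases hy : y.1 = x
    · simp [Finset.subtypeInsertEquivOption, hy]
    · simp [Finset.subtypeInsertEquivOption, hy]
  rw [h1, frob_option f hf]
  congr 1
  rw [← Finset.sum_coe_sort J]
  refine Finset.sum_congr rfl fun i _ => ?_
  unfold fr
  congr 1
  funext y
  by_cases hy : y = i
  · subst hy; simp
  · rw [Function.update_of_ne hy, Function.update_of_ne (fun h => hy (Subtype.ext h))]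
    rfl

theorem fr_add {α A B : Type*} [DecidableEq α] [Ring A] [CommRing B]
    (f : A →ₗ[ℤ] B) (hf : Central f) (J : Finset α) :
    ∀ (p : α), p ∈ J → ∀ (a : α → A) (u v : A),
    fr f J (Function.update a p (u + v)) =
      fr f J (Function.update a p u) + fr f J (Function.update a p v) := by
  induction J using Finset.strongInduction with
  | H J ih =>
    intro p hp a u v
    obtain ⟨S, hS, rfl⟩ : ∃ S, p ∉ S ∧ J = insert p S :=
      ⟨J.erase p, by simp, (Finset.insert_erase hp).symm⟩
    have key : ∀ w, fr f (insert p S) (Function.update a p w) =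
        f w * fr f S a - ∑ i ∈ S, fr f S (Function.update a i (a i * w)) := by
      intro w
      rw [fr_insert f hf S p hS, Function.update_self]
      have hne : ∀ y ∈ S, y ≠ p := fun y hy h => hS (h ▸ hy)
      congr 1
      · congr 1
        exact fr_congr f S _ _ fun y hy => Function.update_of_ne (hne y hy) _ _
      · refine Finset.sum_congr rfl fun i hi => ?_
        refine fr_congr f S _ _ fun y hy => ?_
        by_cases hyi : y = i
        · subst hyi
          rw [Function.update_self, Function.update_self, Function.update_of_ne (hne y hy)]
        · rw [Function.update_of_ne hyi, Function.update_of_ne hyi,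
            Function.update_of_ne (hne y hy)]
    rw [key, key, key, map_add]
    have : ∀ i ∈ S, fr f S (Function.update a i (a i * (u + v))) =
        fr f S (Function.update a i (a i * u)) + fr f S (Function.update a i (a i * v)) := by
      intro i hi
      rw [mul_add]
      exact ih S (Finset.ssubset_insert hS) i hi a _ _
    rw [Finset.sum_congr rfl this, Finset.sum_add_distrib]
    ring

theorem fr_sub_sum {α β A B : Type*} [DecidableEq α] [Ring A] [CommRing B]
    (f : A →ₗ[ℤ] B) (hf : Central f) (J : Finset α) (p : α) (hp : p ∈ J) (a : α → A) (u : A)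
    (S : Finset β) (v : β → A) :
    fr f J (Function.update a p (u - ∑ i ∈ S, v i)) =
      fr f J (Function.update a p u) - ∑ i ∈ S, fr f J (Function.update a p (v i)) := by
  let φ : A →+ B := AddMonoidHom.mk' (fun w => fr f J (Function.update a p w))
    (fun u v => fr_add f hf J p hp a u v)
  change φ (u - ∑ i ∈ S, v i) = φ u - ∑ i ∈ S, φ (v i)
  rw [map_sub, map_sum]

/-- replacing one index by another -/
theorem fr_replace {α A B : Type*} [DecidableEq α] [Ring A] [CommRing B]
    (f : A →ₗ[ℤ] B) (hf : Central f) (J : Finset α) (p q : α) (hp : p ∈ J) (hq : q ∉ J)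
    (a : α → A) :
    fr f (insert q (J.erase p)) a = fr f J (Function.update a p (a q)) := by
  obtain ⟨S, hS, rfl⟩ : ∃ S, p ∉ S ∧ J = insert p S :=
      ⟨J.erase p, by simp, (Finset.insert_erase hp).symm⟩
  rw [Finset.erase_insert hS]
  rw [fr_insert f hf S q (fun h => hq (Finset.mem_insert_of_mem h)), fr_insert f hf S p hS,
    Function.update_self]
  have hne : ∀ y ∈ S, y ≠ p := fun y hy h => hS (h ▸ hy)
  congr 1
  · congr 1
    exact fr_congr f S _ _ fun y hy => (Function.update_of_ne (hne y hy) _ _).symm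
  · refine Finset.sum_congr rfl fun i hi => ?_
    refine fr_congr f S _ _ fun y hy => ?_
    by_cases hyi : y = i
    · subst hyi
      rw [Function.update_self, Function.update_self, Function.update_of_ne (hne y hy)]
    · rw [Function.update_of_ne hyi, Function.update_of_ne hyi,
        Function.update_of_ne (hne y hy)]

def parts {α : Type*} [Fintype α] [DecidableEq α] (J : Finset α) : Finset (Finset (Finset α)) :=
  Finset.univ.filter (fun π => IsSetPartition J π)

theorem mem_parts {α : Type*} [Fintype α] [DecidableEq α] (J : Finset α)
    (π : Finset (Finset α)) : π ∈ parts J ↔ (∀ P ∈ π, P.Nonempty) ∧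
      (∀ P ∈ π, ∀ Q ∈ π, ∀ z, z ∈ P → z ∈ Q → P = Q) ∧ (∀ z, z ∈ J ↔ ∃ P ∈ π, z ∈ P) := by
  unfold parts IsSetPartition
  simp only [Finset.mem_filter, Finset.mem_univ, true_and]
  refine and_congr_right fun _ => and_congr ?_ ?_
  · refine forall₄_congr fun P _ Q _ => ?_
    constructor
    · intro h z hz hz'
      by_contra hne
      exact Finset.disjoint_left.1 (h hne) hz hz'
    · intro h hne
      exact Finset.disjoint_left.2 fun z hz hz' => hne (h z hz hz')
  · rw [Finset.ext_iff]
    refine forall_congr' fun z => ?_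
    simp [iff_comm]

theorem inv_aux {α : Type*} [DecidableEq α] (x : α) (π : Finset (Finset α)) (Q : Finset α)
    (hne : ∀ P ∈ π, P.Nonempty) (hdis : ∀ P ∈ π, ∀ Q ∈ π, ∀ z, z ∈ P → z ∈ Q → P = Q)
    (hQ : Q ∈ π) (hxQ : x ∈ Q) :
    insert Q (((insert (Q.erase x) (π.erase Q)).erase ∅).erase (Q.erase x)) = π := by
  have h1 : Q.erase x ∉ π.erase Q := by
    intro h
    have h' := Finset.mem_erase.1 h
    obtain ⟨z, hz⟩ := hne _ h'.2
    exact h'.1 (hdis _ h'.2 Q hQ z hz (Finset.mem_of_mem_erase hz))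
  have h2 : ∅ ∉ π.erase Q := fun h => by simpa using hne _ (Finset.mem_of_mem_erase h)
  rw [Finset.erase_right_comm, Finset.erase_insert h1, Finset.erase_eq_of_notMem h2,
    Finset.insert_erase hQ]

theorem sum_parts_insert {α M : Type*} [Fintype α] [DecidableEq α] [AddCommMonoid M]
    (J : Finset α) (x : α) (hx : x ∉ J) (G : Finset (Finset α) → M) :
    ∑ π ∈ parts (insert x J), G π =
      ∑ π ∈ parts J, ∑ P ∈ insert ∅ π, G (insert (insert x P) (π.erase P)) := by
  have h1 : ∑ π ∈ parts (insert x J), G π =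
      ∑ π ∈ parts (insert x J), ∑ Q ∈ π.filter (fun Q => x ∈ Q), G π := by
    refine Finset.sum_congr rfl fun π hπ => ?_
    rw [mem_parts] at hπ
    obtain ⟨Q, hQ, hxQ⟩ := (hπ.2.2 x).1 (Finset.mem_insert_self _ _)
    have : π.filter (fun Q => x ∈ Q) = {Q} := by
      ext R
      simp only [Finset.mem_filter, Finset.mem_singleton]
      constructor
      · rintro ⟨hR, hxR⟩; exact hπ.2.1 R hR Q hQ x hxR hxQ
      · rintro rfl; exact ⟨hQ, hxQ⟩
    rw [this, Finset.sum_singleton]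
  rw [h1, Finset.sum_sigma', Finset.sum_sigma']
  refine Finset.sum_bij'
    (fun s _ => (⟨(insert (s.2.erase x) (s.1.erase s.2)).erase ∅, s.2.erase x⟩ :
      (_ : Finset (Finset α)) × Finset α))
    (fun s _ => (⟨insert (insert x s.2) (s.1.erase s.2), insert x s.2⟩ :
      (_ : Finset (Finset α)) × Finset α)) ?_ ?_ ?_ ?_ ?_
  · rintro ⟨π, Q⟩ h
    simp only [Finset.mem_sigma, Finset.mem_filter, mem_parts] at h ⊢
    obtain ⟨⟨hne, hdis, hun⟩, hQ, hxQ⟩ := h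
    refine ⟨⟨?_, ?_, ?_⟩, ?_⟩
    · intro P hP
      rw [Finset.nonempty_iff_ne_empty]
      exact (Finset.mem_erase.1 hP).1
    · intro P hP R hR z hzP hzR
      have := hdis
      simp only [Finset.mem_erase, Finset.mem_insert] at hP hR
      grind
    · intro z
      have h2 := hun z
      simp only [Finset.mem_erase, Finset.mem_insert] at h2 ⊢
      constructor
      · intro hz
        have hzx : z ≠ x := fun h => hx (h ▸ hz)
        obtain ⟨P, hP, hzP⟩ := h2.1 (Or.inr hz)
        by_cases hPQ : P = Q
        · subst hPQ
          have hzm : z ∈ P.erase x := Finset.mem_erase.2 ⟨hzx, hzP⟩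
          exact ⟨P.erase x, ⟨Finset.ne_empty_of_mem hzm, Or.inl rfl⟩, hzm⟩
        · exact ⟨P, ⟨Finset.ne_empty_of_mem hzP, Or.inr ⟨hPQ, hP⟩⟩, hzP⟩
      · rintro ⟨P, ⟨_, rfl | ⟨hPQ, hP⟩⟩, hzP⟩
        · have hz2 := Finset.mem_erase.1 hzP
          exact (h2.2 ⟨Q, hQ, hz2.2⟩).resolve_left hz2.1
        · refine (h2.2 ⟨P, hP, hzP⟩).resolve_left ?_
          rintro rfl
          exact hPQ (hdis P hP Q hQ z hzP hxQ)
    · by_cases h0 : Q.erase x = ∅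
      · simp [h0]
      · simp [h0]
  · rintro ⟨π, P⟩ h
    simp only [Finset.mem_sigma, Finset.mem_filter, mem_parts] at h ⊢
    obtain ⟨⟨hne, hdis, hun⟩, hP⟩ := h
    have hxP : ∀ R ∈ π, x ∉ R := fun R hR hxR => hx ((hun x).2 ⟨R, hR, hxR⟩)
    have hP' : ∀ z ∈ P, P ∈ π := by
      intro z hz
      rcases Finset.mem_insert.1 hP with h | h
      · rw [h] at hz; simp at hz
      · exact h
    refine ⟨⟨?_, ?_, ?_⟩, by simp, by simp⟩
    · intro R hR
      rcases Finset.mem_insert.1 hR with h | h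
      · rw [h]; exact Finset.insert_nonempty _ _
      · exact hne R (Finset.mem_of_mem_erase h)
    · have key : ∀ R ∈ π.erase P, ∀ z, z ∈ insert x P → z ∈ R → False := by
        intro R hR z hz hzR
        have hR' := Finset.mem_erase.1 hR
        rcases Finset.mem_insert.1 hz with h | h
        · subst h; exact hxP R hR'.2 hzR
        · exact hR'.1 (hdis R hR'.2 P (hP' z h) z hzR h)
      intro R hR S hS z hzR hzS
      rcases Finset.mem_insert.1 hR with h | h <;> rcases Finset.mem_insert.1 hS with h' | h'
      · rw [h, h']
      · rw [h] at hzR; exact (key S h' z hzR hzS).elim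
      · rw [h'] at hzS; exact (key R h z hzS hzR).elim
      · exact hdis R (Finset.mem_of_mem_erase h) S (Finset.mem_of_mem_erase h') z hzR hzS
    · intro z
      constructor
      · intro hz
        rcases Finset.mem_insert.1 hz with h | h
        · exact ⟨insert x P, by simp, by simp [h]⟩
        · obtain ⟨R, hR, hzR⟩ := (hun z).1 h
          by_cases hRP : R = P
          · exact ⟨insert x P, by simp, by simp [← hRP, hzR]⟩
          · exact ⟨R, by simp [hRP, hR], hzR⟩
      · rintro ⟨R, hR, hzR⟩
        rcases Finset.mem_insert.1 hR with h | h
        · rw [h] at hzR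
          rcases Finset.mem_insert.1 hzR with h | h
          · simp [h]
          · exact Finset.mem_insert_of_mem ((hun z).2 ⟨P, hP' z h, h⟩)
        · exact Finset.mem_insert_of_mem ((hun z).2 ⟨R, Finset.mem_of_mem_erase h, hzR⟩)
  · rintro ⟨π, Q⟩ h
    simp only [Finset.mem_sigma, Finset.mem_filter, mem_parts] at h
    obtain ⟨⟨hne, hdis, hun⟩, hQ, hxQ⟩ := h
    have := inv_aux x π Q hne hdis hQ hxQ
    simp only [Finset.insert_erase hxQ] at this ⊢
    rw [this]
  · rintro ⟨π, P⟩ h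
    simp only [Finset.mem_sigma, mem_parts] at h
    obtain ⟨⟨hne, hdis, hun⟩, hP⟩ := h
    have hxP : ∀ R ∈ π, x ∉ R := fun R hR hxR => hx ((hun x).2 ⟨R, hR, hxR⟩)
    have hemp : ∅ ∉ π := fun h => by simpa using hne _ h
    have hxP' : x ∉ P := by
      rcases Finset.mem_insert.1 hP with h | h
      · simp [h]
      · exact hxP P h
    have h1 : insert x P ∉ π.erase P := fun h =>
      hxP _ (Finset.mem_of_mem_erase h) (Finset.mem_insert_self _ _)
    have h2 : (insert P (π.erase P)).erase ∅ = π := by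
      rcases Finset.mem_insert.1 hP with h | h
      · rw [h, Finset.erase_eq_of_notMem hemp, Finset.erase_insert hemp]
      · rw [Finset.insert_erase h, Finset.erase_eq_of_notMem hemp]
    simp only [Finset.erase_insert hxP', Finset.erase_insert h1, h2]
  · rintro ⟨π, Q⟩ h
    simp only [Finset.mem_sigma, Finset.mem_filter, mem_parts] at h
    obtain ⟨⟨hne, hdis, hun⟩, hQ, hxQ⟩ := h
    have := inv_aux x π Q hne hdis hQ hxQ
    simp only [Finset.insert_erase hxQ] at this ⊢
    rw [this]

theorem main {α A B C : Type*} [Fintype α] [DecidableEq α] [Ring A] [CommRing B] [CommRing C]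
    (g : A →ₗ[ℤ] B) (f : B →ₗ[ℤ] C) (hg : Central g) (hf : Central f) (J : Finset α) :
    ∀ a : α → A, fr (f ∘ₗ g) J a = ∑ π ∈ parts J, fr f π (fun P => fr g P a) := by
  have hh : Central (f ∘ₗ g) := by
    intro u v
    simp [hg u v]
  induction J using Finset.induction_on with
  | empty =>
    intro a
    have : parts (∅ : Finset α) = {∅} := by
      ext π
      rw [mem_parts, Finset.mem_singleton]
      constructor
      · rintro ⟨h1, _, h3⟩
        rw [Finset.eq_empty_iff_forall_notMem]
        intro P hP
        obtain ⟨z, hz⟩ := h1 P hP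
        exact absurd ((h3 z).2 ⟨P, hP, hz⟩) (by simp)
      · rintro rfl; simp
    rw [this, Finset.sum_singleton, fr_empty, fr_empty]
  | insert x J hx ih =>
    intro a
    rw [fr_insert _ hh J x hx, sum_parts_insert J x hx, ih a]
    have h1 : ∀ i ∈ J, fr (f ∘ₗ g) J (Function.update a i (a i * a x)) =
        ∑ π ∈ parts J, fr f π (fun P => fr g P (Function.update a i (a i * a x))) :=
      fun i _ => ih _
    rw [Finset.sum_congr rfl h1, Finset.sum_comm, Finset.mul_sum, ← Finset.sum_sub_distrib]
    refine Finset.sum_congr rfl fun π hπ => ?_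
    rw [mem_parts] at hπ
    obtain ⟨hne, hdis, hun⟩ := hπ
    have hemp : ∅ ∉ π := fun h => by simpa using hne _ h
    have hxP : ∀ P ∈ π, x ∉ P := fun P hP hxP => hx ((hun x).2 ⟨P, hP, hxP⟩)
    have hsing : fr g {x} a = g (a x) := by
      have := fr_insert g hg ∅ x (by simp) a
      rw [fr_empty] at this
      simpa using this
    rw [Finset.sum_insert hemp, Finset.erase_eq_of_notMem hemp]
    have h2 : (insert x ∅ : Finset α) = {x} := rfl
    rw [h2, fr_insert f hf π {x} (fun h => hxP _ h (by simp)), hsing]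
    have h3 : ∀ P ∈ π, fr f (insert (insert x P) (π.erase P)) (fun P => fr g P a) =
        fr f π (Function.update (fun P => fr g P a) P (fr g P a * g (a x))) -
        ∑ i ∈ P, fr f π (fun P => fr g P (Function.update a i (a i * a x))) := by
      intro P hP
      rw [fr_replace f hf π P (insert x P) hP (fun h => hxP _ h (by simp)),
        fr_insert g hg P x (hxP P hP), fr_sub_sum f hf π P hP, mul_comm]
      congr 1
      refine Finset.sum_congr rfl fun i hi => ?_
      refine fr_congr f π _ _ fun Q hQ => ?_
      by_cases hQP : Q = P
      · subst hQP; rw [Function.update_self]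
      · rw [Function.update_of_ne hQP]
        refine fr_congr g Q _ _ fun y hy => ?_
        rw [Function.update_of_ne]
        rintro rfl
        exact hQP (hdis Q hQ P hP y hy hi)
    rw [Finset.sum_congr rfl h3, Finset.sum_sub_distrib]
    have hJ : J = π.biUnion id := by
      ext z; rw [hun z]; simp
    have h4 : ∑ i ∈ J, fr f π (fun P => fr g P (Function.update a i (a i * a x))) =
        ∑ P ∈ π, ∑ i ∈ P, fr f π (fun P => fr g P (Function.update a i (a i * a x))) := by
      rw [hJ, Finset.sum_biUnion]
      · rfl
      · intro P hP Q hQ hPQ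
        exact Finset.disjoint_left.2 fun z hz hz' => hPQ (hdis P hP Q hQ z hz hz')
    rw [h4]
    simp only [LinearMap.comp_apply]
    ring

end FrobAux

/-- Composition formula: `h_n(a₁,…,aₙ) = ∑_{π ∈ Π_{[n]}} f_k(b_{P₁},…,b_{P_k})`, where
`h = f ∘ g` and `b_P = g_{|P|}(a_p : p ∈ P)`. -/
theorem stmt6 {A B C : Type*} [Ring A] [CommRing B] [CommRing C]
    (g : A →ₗ[ℤ] B) (f : B →ₗ[ℤ] C) (hg : Central g) (hf : Central f)
    (n : ℕ) (a : Fin n → A) :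
    frob (f ∘ₗ g) a =
      ∑ π ∈ Finset.univ.filter
          (fun π : Finset (Finset (Fin n)) => IsSetPartition Finset.univ π),
        frob f (fun P : {P // P ∈ π} =>
          frob g (fun x : {x // x ∈ P.1} => a x.1)) := by
  have h := FrobAux.main g f hg hf Finset.univ a
  have hh : Central (f ∘ₗ g) := by
    intro u v
    simp [hg u v]
  have e := FrobAux.frob_reindex (f ∘ₗ g) hh
    (Equiv.subtypeUnivEquiv (p := fun x : Fin n => x ∈ Finset.univ) Finset.mem_univ) a
  rw [← e]
  exact h
end
end

section
/- Let A, B and C be three rings with B and C commutative, and let n, m ∈ ℕ. If f : B → C is an n-homomorphism and g : A → B is an m-homomorphism, then the composition f ∘ g : A → C is an (n·m)-homomorphism. -/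
open scoped Classical

noncomputable section

/-- Sum of `h` over all ways to multiply one entry of a list by `a` on the right. -/
def sE {A M : Type*} [Ring A] [AddCommGroup M] (a : A) : List A → (List A → M) → M
  | [], _ => 0
  | b :: l, h => h (b * a :: l) + sE a l (fun l' => h (b :: l'))

def sEE {A M : Type*} [Ring A] [AddCommGroup M] (a : A) :
    List (List A) → (List (List A) → M) → M
  | [], _ => 0
  | P :: p, h => sE a P (fun P' => h (P' :: p)) + sEE a p (fun p' => h (P :: p'))

def sT {A M : Type*} [AddCommGroup M] (a : A) :
    List (List A) → (List (List A) → M) → M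
  | [], _ => 0
  | P :: p, h => h ((a :: P) :: p) + sT a p (fun p' => h (P :: p'))

/-- Sum of `h` over all set partitions of (the index set of) a list. -/
def sS {A M : Type*} [AddCommGroup M] : List A → (List (List A) → M) → M
  | [], h => h []
  | a :: l, h => sS l (fun p => h ([a] :: p) + sT a p h)

def rFn {A B : Type*} [Ring A] [CommRing B] (f : A →ₗ[ℤ] B) : ℕ → List A → B
  | 0, [] => 1
  | 0, _ :: _ => 0
  | _ + 1, [] => 1
  | k + 1, a :: l => f a * rFn f k l - sE a l (rFn f k)

def rF {A B : Type*} [Ring A] [CommRing B] (f : A →ₗ[ℤ] B) (l : List A) : B :=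
  rFn f l.length l

set_option linter.unusedSectionVars false

section lin
variable {A M : Type*} [Ring A] [AddCommGroup M]

lemma sE_congr (a : A) (l : List A) (h k : List A → M)
    (H : ∀ l', l'.length = l.length → h l' = k l') : sE a l h = sE a l k := by
  induction l generalizing h k with
  | nil => rfl
  | cons b l ih =>
    simp only [sE]
    rw [H _ (by simp), ih _ _ (fun l' hl => H _ (by simp [hl]))]

lemma sE_add (a : A) (l : List A) (h k : List A → M) :
    sE a l (fun x => h x + k x) = sE a l h + sE a l k := by
  induction l generalizing h k with
  | nil => simp [sE]
  | cons b l ih => simp only [sE, ih]; abel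

lemma sE_zero (a : A) (l : List A) : sE a l (fun _ => (0 : M)) = 0 := by
  induction l with
  | nil => simp [sE]
  | cons b l ih => simp only [sE, ih]; abel

lemma sT_add (a : A) (l : List (List A)) (h k : List (List A) → M) :
    sT a l (fun x => h x + k x) = sT a l h + sT a l k := by
  induction l generalizing h k with
  | nil => simp [sT]
  | cons b l ih => simp only [sT, ih]; abel

lemma sT_zero (a : A) (l : List (List A)) : sT a l (fun _ => (0 : M)) = 0 := by
  induction l with
  | nil => simp [sT]
  | cons b l ih => simp only [sT, ih]; abel

lemma sEE_add (a : A) (l : List (List A)) (h k : List (List A) → M) :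
    sEE a l (fun x => h x + k x) = sEE a l h + sEE a l k := by
  induction l generalizing h k with
  | nil => simp [sEE]
  | cons b l ih => simp only [sEE, ih, sE_add]; abel

lemma sS_add (l : List A) (h k : List (List A) → M) :
    sS l (fun x => h x + k x) = sS l h + sS l k := by
  induction l generalizing h k with
  | nil => simp [sS]
  | cons b l ih =>
    simp only [sS, ← ih, sT_add]
    congr 1; funext p; abel

lemma sS_zero (l : List A) : sS l (fun _ => (0 : M)) = 0 := by
  induction l with
  | nil => simp [sS]
  | cons b l ih => simpa [sS, sT_zero] using ih

lemma sS_neg (l : List A) (h : List (List A) → M) :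
    sS l (fun x => - h x) = - sS l h := by
  rw [eq_neg_iff_add_eq_zero, ← sS_add]
  simp [sS_zero]

lemma sT_mul {R : Type*} [CommRing R] (c : R) (a : A) (l : List (List A))
    (h : List (List A) → R) : sT a l (fun x => c * h x) = c * sT a l h := by
  induction l generalizing h with
  | nil => simp [sT]
  | cons b l ih => simp only [sT, ih]; ring

lemma sS_mul {R : Type*} [CommRing R] (c : R) (l : List A)
    (h : List (List A) → R) : sS l (fun x => c * h x) = c * sS l h := by
  induction l generalizing h with
  | nil => simp [sS]
  | cons b l ih => simp only [sS, ← ih, sT_mul, mul_add]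

/-- swapping `sT` with single-block operation -/
lemma sE_sT (a b : A) (P : List A) (p : List (List A)) (h : List (List A) → List A → M) :
    sE a P (fun P' => sT b p (fun p' => h p' P')) = sT b p (fun p' => sE a P (h p')) := by
  induction p generalizing h with
  | nil => simp [sT, sE_zero]
  | cons Q p ih => simp only [sT, sE_add, ih]

lemma key_T (a b : A) (p : List (List A)) (h : List (List A) → M) :
    sT b p (fun q => sEE a q h) = sT (b * a) p h + sEE a p (fun q => sT b q h) := by
  induction p generalizing h with
  | nil => simp [sT, sEE]
  | cons P p ih =>
    simp only [sT, sEE, sE, sT_add, ih, sE_add, sEE_add, sE_sT]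
    abel

lemma key_S (a : A) (l : List A) (h : List (List A) → M) :
    sE a l (fun l' => sS l' h) = sS l (fun p => sEE a p h) := by
  induction l generalizing h with
  | nil => simp [sE, sS, sEE]
  | cons b l ih =>
    simp only [sE, sS, ih, sEE, ← sS_add, key_T, sEE_add]
    congr 1; funext p; abel

/-- additive in each slot -/
def Slot (h : List A → M) : Prop :=
  ∀ l₁ x y l₂, h (l₁ ++ (x + y) :: l₂) = h (l₁ ++ x :: l₂) + h (l₁ ++ y :: l₂)

lemma Slot.cons {h : List A → M} (H : Slot h) (b : A) : Slot (fun l => h (b :: l)) :=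
  fun l₁ x y l₂ => H (b :: l₁) x y l₂

lemma sE_add_left {h : List A → M} (H : Slot h) (x y : A) (l : List A) :
    sE (x + y) l h = sE x l h + sE y l h := by
  induction l generalizing h with
  | nil => simp [sE]
  | cons b l ih =>
    have := H [] (b * x) (b * y) l
    simp only [List.nil_append] at this
    simp only [sE, mul_add, this, ih (H.cons b)]; abel

lemma sE_slot {h : List A → M} (H : Slot h) (a : A) : Slot (fun l => sE a l h) := by
  intro l₁ x y l₂
  induction l₁ generalizing h with
  | nil =>
    have h1 := H [] (x * a) (y * a) l₂
    have h2 : ∀ l, h ((x + y) :: l) = h (x :: l) + h (y :: l) := fun l => H [] x y l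
    simp only [List.nil_append] at h1
    simp only [List.nil_append, sE, add_mul, h1, h2, sE_add]; abel
  | cons b l ih =>
    have h1 := H (b * a :: l) x y l₂
    have := ih (H.cons b)
    simp only [List.cons_append] at h1 this
    simp only [List.cons_append, sE, h1, this]; abel

lemma Slot.zero {h : List A → M} (H : Slot h) (l₁ l₂) : h (l₁ ++ 0 :: l₂) = 0 := by
  have := H l₁ 0 0 l₂
  simpa using this

lemma Slot.neg {h : List A → M} (H : Slot h) (l₁ x l₂) :
    h (l₁ ++ (-x) :: l₂) = - h (l₁ ++ x :: l₂) := by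
  rw [eq_neg_iff_add_eq_zero, ← H]
  simp [H.zero]

lemma Slot.sE {h : List A → M} (H : Slot h) {A' : Type*} [Ring A'] (a : A') (P : List A')
    (u : List A' → A) (q : List A) :
    h (_root_.sE a P u :: q) = _root_.sE a P (fun P' => h (u P' :: q)) := by
  induction P generalizing u with
  | nil => simpa [_root_.sE] using H.zero [] q
  | cons b P ih =>
    have := H [] (u (b * a :: P)) (_root_.sE a P (fun P' => u (b :: P'))) q
    simp only [List.nil_append] at this
    simp only [_root_.sE, this, ih]

end lin

section rF
variable {A B C : Type*} [Ring A] [CommRing B] [CommRing C]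

lemma rF_nil (f : A →ₗ[ℤ] B) : rF f [] = 1 := rfl

lemma rF_cons (f : A →ₗ[ℤ] B) (a : A) (l : List A) :
    rF f (a :: l) = f a * rF f l - sE a l (rF f) := by
  simp only [rF, List.length_cons, rFn]
  congr 1
  apply sE_congr
  intro l' h
  rw [rF, h]

lemma rFn_slot (f : A →ₗ[ℤ] B) (k : ℕ) : Slot (rFn f k) := by
  induction k with
  | zero =>
    intro l₁ x y l₂
    cases l₁ <;> simp [rFn]
  | succ k ih =>
    intro l₁ x y l₂
    cases l₁ with
    | nil =>
      simp only [List.nil_append, rFn, sE_add_left ih, map_add]; ring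
    | cons b l₁ =>
      have h1 := ih l₁ x y l₂
      have h2 := sE_slot ih b l₁ x y l₂
      simp only at h2
      simp only [List.cons_append, rFn, h1, h2]; ring

lemma rF_slot (f : A →ₗ[ℤ] B) : Slot (rF f) := by
  intro l₁ x y l₂
  have h := rFn_slot f (l₁ ++ x :: l₂).length l₁ x y l₂
  simpa [rF] using h

lemma rF_vanish (f : A →ₗ[ℤ] B) (n : ℕ) (H : ∀ l : List A, l.length = n + 1 → rF f l = 0)
    (l : List A) (hl : n + 1 ≤ l.length) : rF f l = 0 := by
  induction hk : l.length generalizing l with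
  | zero => omega
  | succ k ih =>
    rcases hl.eq_or_lt with h | h
    · exact H _ h.symm
    · match l with
      | [] => simp at hk
      | a :: l =>
        simp only [List.length_cons, add_left_inj] at hk h
        rw [rF_cons, ih l (by omega) hk, sE_congr a l _ (fun _ => 0), sE_zero]
        · simp
        · intro l' h'
          exact ih l' (by omega) (by omega)

lemma comp_T (g : A →ₗ[ℤ] B) {h : List B → C} (H : Slot h) (a : A) (p : List (List A)) :
    sT a p (fun q => h (q.map (rF g))) =
      sE (g a) (p.map (rF g)) h - sEE a p (fun q => h (q.map (rF g))) := by
  induction p generalizing h with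
  | nil => simp [sT, sE, sEE]
  | cons P p ih =>
    simp only [sT, List.map_cons, sE, sEE]
    rw [ih (H.cons _), rF_cons, sub_eq_add_neg]
    have h1 := H [] (g a * rF g P) (- sE a P (rF g)) (p.map (rF g))
    have h2 := H.neg [] (sE a P (rF g)) (p.map (rF g))
    simp only [List.nil_append] at h1 h2
    rw [h1, h2, H.sE, mul_comm]
    abel

lemma comp_formula (f : B →ₗ[ℤ] C) (g : A →ₗ[ℤ] B) (l : List A) :
    rF (f ∘ₗ g) l = sS l (fun p => rF f (p.map (rF g))) := by
  induction hk : l.length generalizing l with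
  | zero =>
    obtain rfl : l = [] := by simpa using hk
    simp [sS, rF_nil]
  | succ k ih =>
    match l with
    | [] => simp at hk
    | a :: l =>
      simp only [List.length_cons, add_left_inj] at hk
      rw [rF_cons, ih l hk, sE_congr a l _ (fun l' => sS l' (fun p => rF f (p.map (rF g)))), key_S,
        ← sS_mul, sub_eq_add_neg, ← sS_neg, ← sS_add, sS]
      · congr 1
        funext p
        rw [comp_T g (rF_slot f)]
        have : rF g [a] = g a := by simp [rF_cons, rF_nil, sE]
        simp only [List.map_cons, this]
        rw [rF_cons]
        simp only [LinearMap.comp_apply]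
        ring
      · intro l' h'
        exact ih l' (by omega)

lemma sT_vanish (a : A) (p : List (List A)) (h : List (List A) → C)
    (H : ∀ q, (q.map List.length).sum = (p.map List.length).sum + 1 → h q = 0) :
    sT a p h = 0 := by
  induction p generalizing h with
  | nil => rfl
  | cons P p ih =>
    simp only [sT]
    rw [H _ (by simp; ring), ih, add_zero]
    intro q hq
    apply H
    simp [hq]; ring

lemma sS_vanish (l : List A) (h : List (List A) → C)
    (H : ∀ q, (q.map List.length).sum = l.length → h q = 0) : sS l h = 0 := by
  induction l generalizing h with
  | nil => exact H _ (by simp)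
  | cons a l ih =>
    simp only [sS]
    apply ih
    intro q hq
    rw [H _ (by simp [hq]; ring), sT_vanish, add_zero]
    intro q' hq'
    apply H
    rw [hq', hq]; simp

lemma comp_vanish (f : B →ₗ[ℤ] C) (g : A →ₗ[ℤ] B) (n m : ℕ)
    (hf : ∀ l : List B, l.length = n + 1 → rF f l = 0)
    (hg : ∀ l : List A, l.length = m + 1 → rF g l = 0)
    (l : List A) (hl : l.length = n * m + 1) : rF (f ∘ₗ g) l = 0 := by
  rw [comp_formula]
  apply sS_vanish
  intro q hq
  by_cases hn : n + 1 ≤ q.length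
  · exact rF_vanish f n hf _ (by simpa using hn)
  · by_cases hm : ∃ P ∈ q, m + 1 ≤ P.length
    · obtain ⟨P, hP, hPm⟩ := hm
      obtain ⟨s, t, rfl⟩ := List.append_of_mem hP
      rw [List.map_append, List.map_cons, rF_vanish g m hg P hPm]
      exact (rF_slot f).zero _ _
    · exfalso
      push Not at hm hn
      have h1 : (q.map List.length).sum ≤ (q.map List.length).length • m := by
        apply List.sum_le_card_nsmul
        intro x hx
        obtain ⟨P, hP, rfl⟩ := List.mem_map.1 hx
        have := hm P hP
        omega
      simp only [List.length_map, smul_eq_mul] at h1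
      have h2 : q.length * m ≤ n * m := Nat.mul_le_mul_right _ (by omega)
      omega

end rF

section cyc
variable {A B : Type*} [Ring A] [CommRing B]

lemma minPer_pos {ι : Type*} [Fintype ι] (σ : Equiv.Perm ι) (x : ι) :
    0 < Function.minimalPeriod (⇑σ) x := by
  apply Function.minimalPeriod_pos_of_mem_periodicPts
  exact Function.mem_periodicPts.2 ⟨orderOf σ, orderOf_pos σ, by
    rw [Function.IsPeriodicPt, Function.IsFixedPt, ← Equiv.Perm.coe_pow, pow_orderOf_eq_one]; rfl⟩

lemma pow_minPer {ι : Type*} (σ : Equiv.Perm ι) (x : ι) :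
    (σ ^ Function.minimalPeriod (⇑σ) x) x = x := by
  rw [Equiv.Perm.coe_pow]; exact Function.iterate_minimalPeriod

lemma cycleProd_succ {ι : Type*} [Fintype ι] (f : A →ₗ[ℤ] B) (hf : Central f) (a : ι → A)
    (σ : Equiv.Perm ι) (x : ι) : f (cycleProdAt a σ (σ x)) = f (cycleProdAt a σ x) := by
  unfold cycleProdAt
  rw [Function.minimalPeriod_apply (Function.minimalPeriod_pos_iff_mem_periodicPts.1 (minPer_pos σ x))]
  have hp := pow_minPer σ x
  obtain ⟨k, hk⟩ := Nat.exists_eq_succ_of_ne_zero (minPer_pos σ x).ne'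
  rw [hk] at hp ⊢
  conv_rhs => rw [List.range_succ_eq_map]
  rw [List.range_succ]
  simp only [List.map_append, List.prod_append, List.map_cons, List.prod_cons, List.map_map,
    List.map_nil, List.prod_nil, mul_one, pow_zero, Equiv.Perm.one_apply]
  rw [hf]
  have e : ∀ j : ℕ, (σ ^ j) (σ x) = (σ ^ (j + 1)) x := fun j => by
    rw [pow_succ, Equiv.Perm.mul_apply]
  simp only [e, Nat.succ_eq_add_one] at hp ⊢
  rw [hp]
  rfl

lemma cycleProd_pow {ι : Type*} [Fintype ι] (f : A →ₗ[ℤ] B) (hf : Central f) (a : ι → A)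
    (σ : Equiv.Perm ι) (j : ℕ) (x : ι) :
    f (cycleProdAt a σ ((σ ^ j) x)) = f (cycleProdAt a σ x) := by
  induction j with
  | zero => simp
  | succ j ih => rw [pow_succ', Equiv.Perm.mul_apply, cycleProd_succ f hf, ih]

/-- product over orbit minima is independent of the order -/
lemma prod_min {ι : Type*} [Fintype ι] (σ : Equiv.Perm ι) (r : ι → ℕ) (hr : Function.Injective r)
    (φ : ι → B) (hφ : ∀ j x, φ ((σ ^ (j : ℕ)) x) = φ x) :
    (∏ x : ι, if ∀ j : ℕ, r x ≤ r ((σ ^ j) x) then φ x else 1) =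
      ∏ q : Quotient (Equiv.Perm.SameCycle.setoid σ), φ q.out := by
  rw [← Finset.prod_fiberwise (s := Finset.univ)
    (g := fun x => (Quotient.mk (Equiv.Perm.SameCycle.setoid σ) x))]
  apply Finset.prod_congr rfl
  intro q _
  have hsc : ∀ x y, Quotient.mk (Equiv.Perm.SameCycle.setoid σ) x = Quotient.mk _ y ↔
      ∃ j : ℕ, (σ ^ j) x = y := by
    intro x y
    rw [Quotient.eq]
    constructor
    · intro h
      obtain ⟨j, _, hj⟩ := Equiv.Perm.SameCycle.exists_pow_eq' h
      exact ⟨j, hj⟩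
    · rintro ⟨j, hj⟩
      exact ⟨j, by simpa using hj⟩
  obtain ⟨x₀, hx₀, hmin⟩ := Finset.exists_min_image
    (Finset.univ.filter (fun x => Quotient.mk (Equiv.Perm.SameCycle.setoid σ) x = q)) r
    ⟨q.out, by simp⟩
  simp only [Finset.mem_filter, Finset.mem_univ, true_and] at hx₀ hmin
  rw [Finset.prod_eq_single x₀]
  · rw [if_pos]
    · have : Quotient.mk (Equiv.Perm.SameCycle.setoid σ) x₀ = Quotient.mk _ q.out := by
        rw [hx₀, Quotient.out_eq]
      obtain ⟨j, hj⟩ := (hsc _ _).1 this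
      rw [← hj, hφ]
    · intro j
      apply hmin
      rw [← hx₀]
      exact ((hsc _ _).2 ⟨j, rfl⟩).symm
  · intro y hy hne
    simp only [Finset.mem_filter, Finset.mem_univ, true_and] at hy
    rw [if_neg]
    intro h
    obtain ⟨j, hj⟩ := (hsc y x₀).1 (hy.trans hx₀.symm)
    have h1 := h j
    rw [hj] at h1
    exact hne (hr (le_antisymm h1 (hmin y hy)))
  · intro h
    simp [hx₀] at h

lemma frob_eq_s7 {k : ℕ} (f : A →ₗ[ℤ] B) (hf : Central f) (a : Fin k → A) :
    frob f a = ∑ σ : Equiv.Perm (Fin k), (Equiv.Perm.sign σ : ℤ) •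
      ∏ x : Fin k, if ∀ j : ℕ, (σ ^ j) x ≤ x then f (cycleProdAt a σ x) else 1 := by
  unfold frob
  apply Finset.sum_congr rfl
  intro σ _
  congr 1
  have h1 := prod_min σ (fun x => ((Fintype.equivFin (Fin k)) x : ℕ))
    (fun x y h => (Fintype.equivFin (Fin k)).injective (Fin.ext h))
    (fun x => f (cycleProdAt a σ x)) (fun j x => cycleProd_pow f hf a σ j x)
  have h2 := prod_min σ (fun x => k - (x : ℕ))
    (fun x y h => by simp only at h; apply Fin.ext; omega)
    (fun x => f (cycleProdAt a σ x)) (fun j x => cycleProd_pow f hf a σ j x)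
  refine Eq.trans ?_ (h1.trans (h2.symm.trans ?_))
  · rfl
  · apply Finset.prod_congr rfl
    intro x _
    apply if_congr _ rfl rfl
    apply forall_congr'
    intro j
    rw [Fin.le_def]
    omega

/-- `σ` arises from `e` by inserting `0` right after `p` (or as a fixed point if `p = 0`). -/
structure Ins {k : ℕ} (σ : Equiv.Perm (Fin (k + 1))) (e : Equiv.Perm (Fin k))
    (p : Fin (k + 1)) : Prop where
  fix : p = 0 → σ 0 = 0
  ne : ∀ y : Fin k, y.succ ≠ p → σ y.succ = (e y).succ
  eq : ∀ y : Fin k, y.succ = p → σ y.succ = 0 ∧ σ 0 = (e y).succ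

/-- modified family -/
def modf {k : ℕ} (a : Fin (k + 1) → A) (p : Fin (k + 1)) (i : Fin k) : A :=
  if i.succ = p then a i.succ * a 0 else a i.succ

lemma Ins.walk {k : ℕ} {σ : Equiv.Perm (Fin (k + 1))} {e : Equiv.Perm (Fin k)}
    {p : Fin (k + 1)} (H : Ins σ e p) (a : Fin (k + 1) → A) (i : Fin k) (N : ℕ) :
    ∃ M : ℕ, N ≤ M ∧ (N = 0 → M = 0) ∧ (σ ^ M) i.succ = ((e ^ N) i).succ ∧
      ((List.range M).map (fun j => a ((σ ^ j) i.succ))).prod =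
        ((List.range N).map (fun j => modf a p ((e ^ j) i))).prod ∧
      ∀ t, 0 < t → t < M → (σ ^ t) i.succ = 0 ∨
        ∃ s, 0 < s ∧ s < N ∧ (σ ^ t) i.succ = ((e ^ s) i).succ := by
  induction N with
  | zero => exact ⟨0, by simp⟩
  | succ N ih =>
    obtain ⟨M, h1, h2, h3, h4, h5⟩ := ih
    by_cases hy : ((e ^ N) i).succ = p
    · obtain ⟨q1, q2⟩ := H.eq _ hy
      have s1 : (σ ^ (M + 1)) i.succ = 0 := by
        rw [pow_succ', Equiv.Perm.mul_apply, h3, q1]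
      have s2 : (σ ^ (M + 2)) i.succ = ((e ^ (N + 1)) i).succ := by
        rw [pow_succ', Equiv.Perm.mul_apply, s1, q2, pow_succ', Equiv.Perm.mul_apply]
      refine ⟨M + 2, by omega, by omega, s2, ?_, ?_⟩
      · rw [List.range_succ, List.range_succ, List.range_succ]
        simp only [List.map_append, List.prod_append, List.map_cons, List.map_nil, List.prod_cons,
          List.prod_nil, mul_one, h4, s1, h3, modf, if_pos hy, mul_assoc]
      · intro t ht0 ht
        rcases lt_trichotomy t M with h | rfl | h
        · rcases h5 t ht0 h with h | ⟨s, hs, hs', hs''⟩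
          · exact Or.inl h
          · exact Or.inr ⟨s, hs, by omega, hs''⟩
        · exact Or.inr ⟨N, by omega, by omega, h3⟩
        · obtain rfl : t = M + 1 := by omega
          exact Or.inl s1
    · have q1 := H.ne _ hy
      have s1 : (σ ^ (M + 1)) i.succ = ((e ^ (N + 1)) i).succ := by
        rw [pow_succ', Equiv.Perm.mul_apply, h3, q1, pow_succ', Equiv.Perm.mul_apply]
      refine ⟨M + 1, by omega, by omega, s1, ?_, ?_⟩
      · rw [List.range_succ, List.range_succ]
        simp only [List.map_append, List.prod_append, List.map_cons, List.map_nil, List.prod_cons,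
          List.prod_nil, mul_one, h4, h3, modf, if_neg hy]
      · intro t ht0 ht
        rcases (Nat.lt_succ_iff.1 ht).lt_or_eq with h | rfl
        · rcases h5 t ht0 h with h | ⟨s, hs, hs', hs''⟩
          · exact Or.inl h
          · exact Or.inr ⟨s, hs, by omega, hs''⟩
        · exact Or.inr ⟨N, by omega, by omega, h3⟩

lemma Ins.cycleProd {k : ℕ} {σ : Equiv.Perm (Fin (k + 1))} {e : Equiv.Perm (Fin k)}
    {p : Fin (k + 1)} (H : Ins σ e p) (a : Fin (k + 1) → A) (i : Fin k) :
    cycleProdAt a σ i.succ = cycleProdAt (modf a p) e i := by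
  obtain ⟨M, h1, -, h3, h4, h5⟩ := H.walk a i (Function.minimalPeriod (⇑e) i)
  have hN := minPer_pos e i
  rw [pow_minPer] at h3
  have hM : Function.minimalPeriod (⇑σ) i.succ = M := by
    apply le_antisymm
    · apply Function.IsPeriodicPt.minimalPeriod_le (by omega)
      rw [Function.IsPeriodicPt, Function.IsFixedPt, ← Equiv.Perm.coe_pow, h3]
    · by_contra hlt
      push Not at hlt
      have hp := pow_minPer σ i.succ
      rcases h5 _ (minPer_pos σ i.succ) hlt with h | ⟨s, hs, hs', hs''⟩
      · rw [hp] at h; exact Fin.succ_ne_zero _ h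
      · rw [hp] at hs''
        have : (e ^ s) i = i := (Fin.succ_injective _ hs'').symm
        rw [Equiv.Perm.coe_pow] at this
        have := Function.IsPeriodicPt.minimalPeriod_le hs (f := e) (x := i) this
        omega
  unfold cycleProdAt
  rw [hM, h4]

lemma Ins.min_iff {k : ℕ} {σ : Equiv.Perm (Fin (k + 1))} {e : Equiv.Perm (Fin k)}
    {p : Fin (k + 1)} (H : Ins σ e p) (i : Fin k) :
    (∀ j : ℕ, (σ ^ j) i.succ ≤ i.succ) ↔ ∀ j : ℕ, (e ^ j) i ≤ i := by
  constructor
  · intro h j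
    obtain ⟨M, -, -, h3, -⟩ := H.walk (fun _ => (0 : ℤ)) i j
    have := h M
    rw [h3] at this
    simpa using this
  · intro h t
    obtain ⟨M, h1, -, -, -, h5⟩ := H.walk (fun _ => (0 : ℤ)) i (t + 1)
    rcases Nat.eq_zero_or_pos t with rfl | ht
    · simp
    · rcases h5 t ht (by omega) with h' | ⟨s, -, -, hs⟩
      · rw [h']; exact Fin.zero_le _
      · rw [hs]; simpa using h s

lemma Ins.zero_iff {k : ℕ} {σ : Equiv.Perm (Fin (k + 1))} {e : Equiv.Perm (Fin k)}
    {p : Fin (k + 1)} (H : Ins σ e p) :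
    (∀ j : ℕ, (σ ^ j) 0 ≤ 0) ↔ p = 0 := by
  constructor
  · intro h
    by_contra hp
    obtain ⟨y, rfl⟩ := Fin.exists_succ_eq.2 hp
    have h1 := h 1
    rw [pow_one, (H.eq y rfl).2] at h1
    exact Fin.succ_ne_zero _ (Fin.le_zero_iff.1 h1)
  · intro h j
    have : (σ ^ j) 0 = 0 := by
      induction j with
      | zero => simp
      | succ j ih => rw [pow_succ', Equiv.Perm.mul_apply, ih, H.fix h]
    rw [this]

lemma Ins.cycleProd_zero {k : ℕ} {σ : Equiv.Perm (Fin (k + 1))} {e : Equiv.Perm (Fin k)}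
    (H : Ins σ e 0) (a : Fin (k + 1) → A) : cycleProdAt a σ 0 = a 0 := by
  have h : Function.minimalPeriod (⇑σ) 0 = 1 :=
    Function.minimalPeriod_eq_one_iff_isFixedPt.2 (H.fix rfl)
  simp [cycleProdAt, h]

/-- the decomposition of permutations -/
def dec (k : ℕ) : Fin (k + 1) × Equiv.Perm (Fin k) ≃ Equiv.Perm (Fin (k + 1)) :=
  ((Equiv.refl _).prodCongr (Equiv.inv _)).trans
    (Equiv.Perm.decomposeFin.symm.trans (Equiv.inv _))

lemma dec_apply {k : ℕ} (p : Fin (k + 1)) (e : Equiv.Perm (Fin k)) :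
    dec k (p, e) = (Equiv.Perm.decomposeFin.symm (p, e⁻¹))⁻¹ := rfl

lemma dec_sign {k : ℕ} (p : Fin (k + 1)) (e : Equiv.Perm (Fin k)) :
    Equiv.Perm.sign (dec k (p, e)) = ite (p = 0) 1 (-1) * Equiv.Perm.sign e := by
  rw [dec_apply, Equiv.Perm.sign_inv, Equiv.Perm.decomposeFin.symm_sign, Equiv.Perm.sign_inv]

lemma dec_ins {k : ℕ} (p : Fin (k + 1)) (e : Equiv.Perm (Fin k)) : Ins (dec k (p, e)) e p := by
  rw [dec_apply]
  have he : ∀ y, e⁻¹ (e y) = y := fun y => e.symm_apply_apply y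
  refine ⟨?_, ?_, ?_⟩
  · rintro rfl
    rw [Equiv.Perm.inv_eq_iff_eq]; simp
  · intro y hy
    rw [Equiv.Perm.inv_eq_iff_eq, Equiv.Perm.decomposeFin_symm_apply_succ,
      he, Equiv.swap_apply_of_ne_of_ne (Fin.succ_ne_zero _) hy]
  · rintro y rfl
    constructor
    · rw [Equiv.Perm.inv_eq_iff_eq]; simp
    · rw [Equiv.Perm.inv_eq_iff_eq, Equiv.Perm.decomposeFin_symm_apply_succ,
        he, Equiv.swap_apply_right]

lemma frob_succ {k : ℕ} (f : A →ₗ[ℤ] B) (hf : Central f) (a : Fin (k + 1) → A) :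
    frob f a = f (a 0) * frob f (Fin.tail a) -
      ∑ j : Fin k, frob f (Function.update (Fin.tail a) j (Fin.tail a j * a 0)) := by
  have key : ∀ p : Fin (k + 1), ∑ e : Equiv.Perm (Fin k),
      (Equiv.Perm.sign (dec k (p, e)) : ℤ) •
      (∏ x : Fin (k + 1), if ∀ j : ℕ, ((dec k (p, e)) ^ j) x ≤ x then
        f (cycleProdAt a (dec k (p, e)) x) else 1) =
      (if p = 0 then f (a 0) else -1) * frob f (modf a p) := by
    intro p
    rw [frob_eq_s7 f hf, Finset.mul_sum]
    apply Finset.sum_congr rfl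
    intro e _
    have H := dec_ins p e
    rw [Fin.prod_univ_succ, dec_sign]
    have h2 : (∏ i : Fin k, if ∀ j : ℕ, ((dec k (p, e)) ^ j) i.succ ≤ i.succ then
        f (cycleProdAt a (dec k (p, e)) i.succ) else 1) =
        ∏ i : Fin k, if ∀ j : ℕ, (e ^ j) i ≤ i then f (cycleProdAt (modf a p) e i) else 1 := by
      apply Finset.prod_congr rfl
      intro i _
      rw [H.cycleProd]
      exact if_congr (H.min_iff i) rfl rfl
    rw [h2]
    by_cases hp : p = 0
    · subst hp
      rw [if_pos (H.zero_iff.2 rfl), H.cycleProd_zero]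
      simp only [if_true, one_mul, zsmul_eq_mul]
      ring
    · rw [if_neg (fun h => hp (H.zero_iff.1 h))]
      simp [hp]
  rw [frob_eq_s7 f hf, ← (dec k).sum_comp, Fintype.sum_prod_type]
  simp only [key]
  rw [Fin.sum_univ_succ]
  have m0 : modf a 0 = Fin.tail a := by
    funext i; simp [modf, Fin.tail]
  have m1 : ∀ j : Fin k, modf a j.succ = Function.update (Fin.tail a) j (Fin.tail a j * a 0) := by
    intro j; funext i
    by_cases h : i = j
    · subst h; simp [modf, Fin.tail]
    · simp [modf, Fin.tail, h]
  simp [m0, m1, sub_eq_add_neg]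

lemma sE_ofFn {k : ℕ} (x : A) (b : Fin k → A) (h : List A → B) :
    sE x (List.ofFn b) h = ∑ j : Fin k, h (List.ofFn (Function.update b j (b j * x))) := by
  induction k generalizing h with
  | zero => simp [sE]
  | succ k ih =>
    rw [List.ofFn_succ, sE, ih, Fin.sum_univ_succ]
    congr 1
    · simp [List.ofFn_succ]
    · apply Finset.sum_congr rfl
      intro j _
      rw [List.ofFn_succ (f := Function.update b _ _)]
      congr 2
      congr 1
      funext i
      by_cases hij : i = j
      · subst hij; simp
      · simp [hij]

lemma frob_eq_rF {k : ℕ} (f : A →ₗ[ℤ] B) (hf : Central f) (a : Fin k → A) :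
    frob f a = rF f (List.ofFn a) := by
  induction k with
  | zero => simp [frob, rF_nil]
  | succ k ih =>
    rw [frob_succ f hf, List.ofFn_succ, rF_cons, sE_ofFn, ih]
    simp only [ih]
    rfl

lemma isNHom_iff (n : ℕ) (f : A →ₗ[ℤ] B) : IsNHom n f ↔
    Central f ∧ ∀ l : List A, l.length = n + 1 → rF f l = 0 := by
  unfold IsNHom
  apply and_congr_right
  intro hf
  constructor
  · intro h l hl
    have := h (fun i => l.get (i.cast hl.symm))
    rw [frob_eq_rF f hf] at this
    rw [← this]
    congr 1
    apply List.ext_get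
    · simp [hl]
    · intro i h1 h2
      simp only [List.get_ofFn]
      rfl
  · intro h a
    rw [frob_eq_rF f hf]
    exact h _ (by simp)

end cyc

/-- The composition of an `n`-homomorphism with an `m`-homomorphism is an
`(n·m)`-homomorphism. -/
theorem stmt7 {A B C : Type*} [Ring A] [CommRing B] [CommRing C] (n m : ℕ)
    (f : B →ₗ[ℤ] C) (g : A →ₗ[ℤ] B)
    (hf : IsNHom n f) (hg : IsNHom m g) :
    IsNHom (n * m) (f ∘ₗ g) := by
  rw [isNHom_iff] at hf hg ⊢
  refine ⟨fun a a' => ?_, comp_vanish f g n m hf.2 hg.2⟩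
  simp only [LinearMap.comp_apply, hg.1 a a']
end
end
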